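/- arXiv:q-alg/9606018 — 2 statements merged into one kernel-verified Lean document; each statement's English description precedes it below -/
import Mathlib

section
/- Applying the bispectral involution β to the transformed data (μ_k, γ′_k) returns the original data (λ_i, γ_i): the polynomial x ↦ det Wr(φ^β_1, …, φ^β_N)(x) has exactly the n distinct roots λ_1, …, λ_n, and for each i ∈ {1, …, n} and every entire function u one has (d/dx)[det Wr(φ^β_1, …, φ^β_N, u)](λ_i) + γ_i·det Wr(φ^β_1, …, φ^β_N, u)(λ_i) = 0. Thus β is an involution: (C^β)^β = C. -/
open scoped BigOperators

/-- The generalized Airy operator `L₀ u = u^(r) - ∑_{k=1}^{r-2} a_k u^(k) - x·u`. -/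
noncomputable def airyOp (r : ℕ) (a : ℕ → ℂ) (u : ℂ → ℂ) : ℂ → ℂ :=
  fun x => iteratedDeriv r u x
    - (∑ k ∈ Finset.Ico 1 (r - 1), a k * iteratedDeriv k u x) - x * u x

/-- The Wronskian determinant of an `m`-tuple of functions. -/
noncomputable def wrDet (m : ℕ) (g : Fin m → ℂ → ℂ) (x : ℂ) : ℂ :=
  Matrix.det (Matrix.of fun k s : Fin m => iteratedDeriv k.val (g s) x)

/-- The bordered Wronskian determinant `det Wr(g₁, …, g_m, u)`. -/
noncomputable def wrDetB (m : ℕ) (g : Fin m → ℂ → ℂ) (u : ℂ → ℂ) (x : ℂ) : ℂ :=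
  wrDet (m + 1) (Fin.snoc g u) x

/-- The family `φ_{i,j}(x) = γ_i·f_j(x+λ_i) + f_j'(x+λ_i)`, listed in a fixed order
as `φ_1, …, φ_N` with `N = r·n` (index `k` corresponds to `i = k / r`, `j = k % r`). -/
noncomputable def phiFam (r n : ℕ) (f : ℕ → ℂ → ℂ) (lam gam : ℕ → ℂ) :
    Fin (r * n) → ℂ → ℂ :=
  fun k x => gam (k.val / r) * f (k.val % r) (x + lam (k.val / r)) +
    deriv (f (k.val % r)) (x + lam (k.val / r))

/-- The Vandermonde-type product `V = ∏_{i<j} (λ_i - λ_j)`. -/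
noncomputable def vand (n : ℕ) (lam : ℕ → ℂ) : ℂ :=
  ∏ i ∈ Finset.range n, ∏ j ∈ Finset.Ico (i + 1) n, (lam i - lam j)

namespace AiryBispectral

open Polynomial

/-- The space of entire functions, as a subspace of all functions `ℂ → ℂ`. -/
def entire : Submodule ℂ (ℂ → ℂ) where
  carrier := {u | Differentiable ℂ u}
  add_mem' hu hv := Differentiable.add hu hv
  zero_mem' := differentiable_const (0 : ℂ)
  smul_mem' c _ hu := Differentiable.const_smul hu c

theorem differentiable_deriv {u : ℂ → ℂ} (hu : Differentiable ℂ u) :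
    Differentiable ℂ (deriv u) :=
  differentiableOn_univ.1 (hu.differentiableOn.deriv isOpen_univ)

/-- The type of entire functions. -/
def Entire : Type := entire

noncomputable instance : AddCommGroup Entire := inferInstanceAs (AddCommGroup entire)

noncomputable instance : Module ℂ Entire := inferInstanceAs (Module ℂ entire)

@[ext]
theorem Entire.ext {u v : Entire} (h : ∀ x, u.1 x = v.1 x) : u = v := Subtype.ext (funext h)

/-- Differentiation as an endomorphism of the space of entire functions. -/
noncomputable def dOp : Module.End ℂ Entire where
  toFun u := ⟨deriv u.1, differentiable_deriv u.2⟩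
  map_add' u v := Subtype.ext <| funext fun x => deriv_add (u.2 x) (v.2 x)
  map_smul' c u := Subtype.ext <| funext fun x => deriv_const_smul c (u.2 x)

/-- Multiplication by an entire function. -/
noncomputable def mulOp (c : Entire) : Module.End ℂ Entire where
  toFun u := ⟨fun x => c.1 x * u.1 x, c.2.mul u.2⟩
  map_add' _ _ := Subtype.ext <| funext fun _ => mul_add _ _ _
  map_smul' _ _ := Subtype.ext <| funext fun _ => mul_left_comm _ _ _

/-- The coordinate function. -/
noncomputable def coord : Entire := ⟨fun x => x, differentiable_id⟩

/-- The generalized Airy operator as an endomorphism of the space of entire functions. -/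
noncomputable def airyEnd (r : ℕ) (a : ℕ → ℂ) : Module.End ℂ Entire :=
  dOp ^ r - ∑ k ∈ Finset.Ico 1 (r - 1), a k • dOp ^ k - mulOp coord

/-- Translation of an entire function. -/
noncomputable def shift (z : ℂ) (u : Entire) : Entire :=
  ⟨fun x => u.1 (x + z), u.2.comp (differentiable_id.add_const z)⟩

theorem dOp_apply (u : Entire) (x : ℂ) : (dOp u).1 x = deriv u.1 x := rfl

theorem mulOp_apply (c u : Entire) (x : ℂ) : (mulOp c u).1 x = c.1 x * u.1 x := rfl

theorem dOp_pow_apply (k : ℕ) (u : Entire) : ((dOp ^ k) u).1 = iteratedDeriv k u.1 := by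
  induction k with
  | zero => simp
  | succ k ih =>
    rw [pow_succ', iteratedDeriv_succ, ← ih]
    rfl

theorem sum_apply {ι : Type*} (s : Finset ι) (g : ι → Entire) (x : ℂ) :
    (∑ i ∈ s, g i).1 x = ∑ i ∈ s, (g i).1 x := by
  have h : (∑ i ∈ s, g i).1 = ∑ i ∈ s, (g i).1 :=
    map_sum (entire.subtype.toAddMonoidHom : Entire →+ (ℂ → ℂ)) g s
  rw [h, Finset.sum_apply]

theorem smul_apply (c : ℂ) (u : Entire) (x : ℂ) : (c • u).1 x = c * u.1 x := rfl

theorem add_apply (u v : Entire) (x : ℂ) : (u + v).1 x = u.1 x + v.1 x := rfl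

theorem sub_apply (u v : Entire) (x : ℂ) : (u - v).1 x = u.1 x - v.1 x := rfl

theorem airyEnd_apply (r : ℕ) (a : ℕ → ℂ) (u : Entire) (x : ℂ) :
    (airyEnd r a u).1 x = airyOp r a u.1 x := by
  simp only [airyEnd, airyOp, LinearMap.sub_apply, LinearMap.sum_apply, LinearMap.smul_apply,
    sub_apply, sum_apply, smul_apply, dOp_pow_apply, mulOp_apply]
  rfl

theorem dOp_pow_shift (k : ℕ) (z : ℂ) (u : Entire) (x : ℂ) :
    ((dOp ^ k) (shift z u)).1 x = ((dOp ^ k) u).1 (x + z) := by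
  rw [dOp_pow_apply, dOp_pow_apply]
  exact congrFun (iteratedDeriv_comp_add_const k u.1 z) x

theorem airyEnd_shift (r : ℕ) (a : ℕ → ℂ) (u : Entire) (hu : airyEnd r a u = 0) (z : ℂ) :
    airyEnd r a (shift z u) = z • shift z u := by
  ext x
  have h := congrArg (fun v : Entire => v.1 (x + z)) hu
  simp only [airyEnd, LinearMap.sub_apply, LinearMap.sum_apply, LinearMap.smul_apply,
    sub_apply, sum_apply, smul_apply, mulOp_apply, dOp_pow_shift] at h ⊢
  simp only [coord, shift] at h ⊢
  have h0 : (0 : Entire).1 (x + z) = 0 := rfl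
  rw [h0] at h
  linear_combination h

theorem dOp_mulOp (c : Entire) : dOp * mulOp c = mulOp (dOp c) + mulOp c * dOp := by
  ext u x
  exact deriv_mul (c.2 x) (u.2 x)

theorem dOp_coord : mulOp (dOp coord) = 1 := by
  ext u x
  have : deriv (fun x : ℂ => x) x = 1 := deriv_id x
  rw [mulOp_apply, dOp_apply, coord, this, one_mul]
  rfl

theorem airyEnd_dOp (r : ℕ) (a : ℕ → ℂ) : airyEnd r a * dOp = dOp * airyEnd r a + 1 := by
  have h := dOp_mulOp coord
  rw [dOp_coord] at h
  simp only [airyEnd, sub_mul, mul_sub, h, Finset.sum_mul, Finset.mul_sum, smul_mul_assoc,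
    mul_smul_comm, ← pow_succ, ← pow_succ']
  abel

/-- Action of polynomials in `L` on the derivative of an eigenvector, when `[L, D] = 1`. -/
theorem aeval_apply_of_commutator {E : Type*} [AddCommGroup E] [Module ℂ E]
    {L D : Module.End ℂ E} (hLD : L * D = D * L + 1) {z : ℂ} {v : E} (hv : L v = z • v)
    (p : ℂ[X]) : aeval L p v = p.eval z • v ∧
      aeval L p (D v) = p.eval z • D v + (derivative p).eval z • v := by
  have hD : L (D v) = z • D v + v := by
    have := congrArg (fun T : Module.End ℂ E => T v) hLD
    simpa [hv] using this
  induction p using Polynomial.induction_on' with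
  | add p q hp hq =>
    simp only [map_add, LinearMap.add_apply, hp, hq, eval_add, add_smul, true_and]
    abel
  | monomial k c =>
    have key : (L ^ k) v = z ^ k • v ∧
        (L ^ k) (D v) = z ^ k • D v + (k * z ^ (k - 1)) • v := by
      induction k with
      | zero => simp
      | succ k ih =>
        refine ⟨?_, ?_⟩
        · rw [pow_succ', Module.End.mul_apply, ih.1, map_smul, hv, smul_smul, pow_succ]
        · rw [pow_succ', Module.End.mul_apply, ih.2, map_add, map_smul, map_smul, hv, hD]
          have : ((k : ℂ) * z ^ (k - 1)) * z = k * z ^ k := by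
            cases k with
            | zero => simp
            | succ k => simp [pow_succ, mul_assoc]
          rw [smul_smul, this, smul_add, smul_smul, add_assoc, ← add_smul, pow_succ]
          simp [add_comm]
          ring_nf
    rw [aeval_monomial]
    simp only [Module.End.mul_apply, Module.algebraMap_end_apply, key, eval_monomial,
      derivative_monomial, smul_add, smul_smul, true_and]
    ring_nf

/-- Differential operators with entire coefficients of order less than `k`. -/
noncomputable def lowOp (k : ℕ) : Submodule ℂ (Module.End ℂ Entire) :=
  Submodule.span ℂ {P | ∃ c : Entire, ∃ m < k, P = mulOp c * dOp ^ m}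

theorem lowOp_mono {k l : ℕ} (h : k ≤ l) : lowOp k ≤ lowOp l := by
  refine Submodule.span_mono ?_
  rintro _ ⟨c, m, hm, rfl⟩
  exact ⟨c, m, hm.trans_le h, rfl⟩

theorem mulOp_mul (c d : Entire) : mulOp c * mulOp d = mulOp (mulOp c d) := by
  ext u x
  exact (mul_assoc _ _ _).symm

theorem mulOp_mul_mem {k : ℕ} {P : Module.End ℂ Entire} (hP : P ∈ lowOp k) (d : Entire) :
    mulOp d * P ∈ lowOp k := by
  induction hP using Submodule.span_induction with
  | mem P h =>
    obtain ⟨c, m, hm, rfl⟩ := h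
    rw [← mul_assoc, mulOp_mul]
    exact Submodule.subset_span ⟨_, m, hm, rfl⟩
  | zero => simp
  | add P Q _ _ hP hQ => rw [mul_add]; exact add_mem hP hQ
  | smul t P _ hP => rw [mul_smul_comm]; exact Submodule.smul_mem _ _ hP

theorem dOp_mul_mem {k : ℕ} {P : Module.End ℂ Entire} (hP : P ∈ lowOp k) :
    dOp * P ∈ lowOp (k + 1) := by
  induction hP using Submodule.span_induction with
  | mem P h =>
    obtain ⟨c, m, hm, rfl⟩ := h
    rw [← mul_assoc, dOp_mulOp, add_mul, mul_assoc, ← pow_succ']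
    exact add_mem (Submodule.subset_span ⟨_, m, hm.trans k.lt_succ_self, rfl⟩)
      (Submodule.subset_span ⟨_, m + 1, Nat.succ_lt_succ hm, rfl⟩)
  | zero => simp
  | add P Q _ _ hP hQ => rw [mul_add]; exact add_mem hP hQ
  | smul t P _ hP => rw [mul_smul_comm]; exact Submodule.smul_mem _ _ hP

theorem dOp_pow_mul_mem {k : ℕ} {P : Module.End ℂ Entire} (hP : P ∈ lowOp k) (j : ℕ) :
    dOp ^ j * P ∈ lowOp (k + j) := by
  induction j with
  | zero => simpa using hP
  | succ j ih =>
    rw [pow_succ', mul_assoc]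
    exact dOp_mul_mem ih

theorem mulOp_one : mulOp ⟨fun _ => 1, differentiable_const 1⟩ = 1 := by
  ext u x
  exact one_mul _

theorem dOp_pow_mem {m k : ℕ} (h : m < k) : dOp ^ m ∈ lowOp k :=
  Submodule.subset_span ⟨⟨fun _ => 1, differentiable_const 1⟩, m, h, by rw [mulOp_one, one_mul]⟩

/-- `P` is a differential operator of order `k` with leading coefficient `1`. -/
def IsMonicOp (k : ℕ) (P : Module.End ℂ Entire) : Prop := P - dOp ^ k ∈ lowOp k

theorem IsMonicOp.mem_lowOp {k l : ℕ} {P : Module.End ℂ Entire} (h : IsMonicOp k P)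
    (hkl : k < l) : P ∈ lowOp l := by
  have := add_mem (lowOp_mono hkl.le h) (dOp_pow_mem hkl)
  rwa [sub_add_cancel] at this

theorem IsMonicOp.dOp_pow_mul {k : ℕ} {P : Module.End ℂ Entire} (h : IsMonicOp k P) (j : ℕ) :
    IsMonicOp (k + j) (dOp ^ j * P) := by
  have := dOp_pow_mul_mem h j
  rwa [mul_sub, ← pow_add, add_comm j k] at this

theorem IsMonicOp.airyEnd_mul {r k : ℕ} (hr : 0 < r) (a : ℕ → ℂ) {P : Module.End ℂ Entire}
    (h : IsMonicOp k P) : IsMonicOp (k + r) (airyEnd r a * P) := by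
  have e : airyEnd r a * P - dOp ^ (k + r) = (dOp ^ r * P - dOp ^ (k + r))
      - ∑ j ∈ Finset.Ico 1 (r - 1), a j • (dOp ^ j * P) - mulOp coord * P := by
    simp only [airyEnd, sub_mul, Finset.sum_mul, smul_mul_assoc]
    abel
  rw [IsMonicOp, e]
  refine sub_mem (sub_mem (h.dOp_pow_mul r) (sum_mem fun j hj => Submodule.smul_mem _ _ ?_)) ?_
  · refine (h.dOp_pow_mul j).mem_lowOp ?_
    have := (Finset.mem_Ico.1 hj).2
    omega
  · exact mulOp_mul_mem (h.mem_lowOp (by omega)) _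

theorem isMonicOp_airyEnd_pow {r : ℕ} (hr : 0 < r) (a : ℕ → ℂ) (b : ℕ) :
    IsMonicOp (r * b) (airyEnd r a ^ b) := by
  induction b with
  | zero => simp [IsMonicOp]
  | succ b ih =>
    rw [pow_succ']
    exact ih.airyEnd_mul hr a

theorem isMonicOp_aeval {r : ℕ} (hr : 0 < r) (a : ℕ → ℂ) {p : ℂ[X]} (hp : p.Monic) :
    IsMonicOp (r * p.natDegree) (aeval (airyEnd r a) p) := by
  have e : aeval (airyEnd r a) p = airyEnd r a ^ p.natDegree +
      ∑ b ∈ Finset.range p.natDegree, p.coeff b • airyEnd r a ^ b := by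
    conv_lhs => rw [hp.as_sum]
    simp [Algebra.smul_def]
  rw [IsMonicOp, e, add_sub_right_comm]
  refine add_mem (isMonicOp_airyEnd_pow hr a _) (sum_mem fun b hb => Submodule.smul_mem _ _ ?_)
  exact (isMonicOp_airyEnd_pow hr a b).mem_lowOp
    (Nat.mul_lt_mul_of_pos_left (Finset.mem_range.1 hb) hr)

theorem exists_coeff_of_mem_lowOp {k : ℕ} {P : Module.End ℂ Entire} (hP : P ∈ lowOp k) (x : ℂ) :
    ∃ c : ℕ → ℂ, ∀ u : Entire,
      (P u).1 x = ∑ m ∈ Finset.range k, c m * iteratedDeriv m u.1 x := by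
  induction hP using Submodule.span_induction with
  | mem P h =>
    obtain ⟨c, m, hm, rfl⟩ := h
    refine ⟨fun j => if j = m then c.1 x else 0, fun u => ?_⟩
    simp only [ite_mul, zero_mul, Finset.sum_ite_eq', Finset.mem_range, hm, if_true,
      Module.End.mul_apply, mulOp_apply, dOp_pow_apply]
  | zero => exact ⟨0, fun u => by simp; rfl⟩
  | add P Q _ _ hP hQ =>
    obtain ⟨c, hc⟩ := hP
    obtain ⟨d, hd⟩ := hQ
    refine ⟨c + d, fun u => ?_⟩
    simp only [LinearMap.add_apply, add_apply, hc, hd, Pi.add_apply, add_mul,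
      Finset.sum_add_distrib]
  | smul t P _ hP =>
    obtain ⟨c, hc⟩ := hP
    refine ⟨fun j => t * c j, fun u => ?_⟩
    simp only [LinearMap.smul_apply, smul_apply, hc, Finset.mul_sum, mul_assoc]

theorem IsMonicOp.exists_coeff {k : ℕ} {P : Module.End ℂ Entire} (hP : IsMonicOp k P) (x : ℂ) :
    ∃ c : ℕ → ℂ, ∀ u : Entire, (P u).1 x =
      iteratedDeriv k u.1 x + ∑ m ∈ Finset.range k, c m * iteratedDeriv m u.1 x := by
  obtain ⟨c, hc⟩ := exists_coeff_of_mem_lowOp hP x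
  refine ⟨c, fun u => ?_⟩
  rw [← hc u, LinearMap.sub_apply, sub_apply, dOp_pow_apply]
  ring

/-- Replacing the derivatives in a Wronskian by monic differential operators of the same orders
does not change the determinant. -/
theorem wrDet_eq_det (m : ℕ) (g : Fin m → Entire) (P : Fin m → Module.End ℂ Entire)
    (hP : ∀ k, IsMonicOp k.val (P k)) (x : ℂ) :
    wrDet m (fun s => (g s).1) x = (Matrix.of fun k s => (P k (g s)).1 x).det := by
  choose c hc using fun k => (hP k).exists_coeff x
  let A : Matrix (Fin m) (Fin m) ℂ := Matrix.of fun k j =>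
    if j = k then 1 else if j < k then c k j else 0
  have hA : A.det = 1 := by
    rw [Matrix.det_of_isLowerTriangular]
    · simp [A]
    · intro i j hij
      have hij : i < j := hij
      simp [A, hij.ne', hij.le]
  have hmul : (Matrix.of fun k s => (P k (g s)).1 x) =
      A * Matrix.of fun k s : Fin m => iteratedDeriv k.val (g s).1 x := by
    ext k s
    rw [Matrix.mul_apply, Matrix.of_apply, hc]
    have h1 : ∀ j : Fin m, A k j * (Matrix.of fun k s : Fin m => iteratedDeriv k.val (g s).1 x) j s
        = (if j = k then iteratedDeriv k.val (g s).1 x else 0)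
          + if j.val < k.val then c k j * iteratedDeriv j.val (g s).1 x else 0 := by
      intro j
      by_cases h : j = k
      · subst h; simp [A]
      · by_cases h' : j < k <;> simp [A, h, h']
    rw [Finset.sum_congr rfl fun j _ => h1 j, Finset.sum_add_distrib, Finset.sum_ite_eq' ]
    simp only [Finset.mem_univ, if_true]
    congr 1
    rw [Fin.sum_univ_eq_sum_range
      (fun j => if j < k.val then c k j * iteratedDeriv j (g s).1 x else 0), ← Finset.sum_filter]
    congr 1
    ext j
    simp only [Finset.mem_range, Finset.mem_filter]
    omega
  rw [hmul, Matrix.det_mul, hA, one_mul, wrDet]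

section Interpolation

variable {n : ℕ} {lam : Fin n → ℂ}

/-- The Calogero–Moser matrix: multiplication by `γ` plus differentiation, in the Lagrange basis
with nodes `λ`. -/
noncomputable def xMat (lam gam : Fin n → ℂ) : Matrix (Fin n) (Fin n) ℂ :=
  Matrix.of fun k i => (if k = i then gam i else 0) +
    (derivative (Lagrange.basis Finset.univ lam k)).eval (lam i)

/-- The values of the derivative of the nodal polynomial at the nodes. -/
noncomputable def cVec (lam : Fin n → ℂ) : Fin n → ℂ :=
  fun i => (derivative (Lagrange.nodal Finset.univ lam)).eval (lam i)

/-- The nodal weights. -/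
noncomputable def bVec (lam : Fin n → ℂ) : Fin n → ℂ :=
  fun i => Lagrange.nodalWeight Finset.univ lam i

theorem X_sub_C_mul_basis (lam : Fin n → ℂ) (k : Fin n) :
    (X - C (lam k)) * Lagrange.basis Finset.univ lam k =
      C (bVec lam k) * Lagrange.nodal Finset.univ lam := by
  rw [Lagrange.nodal_eq_mul_nodal_erase (Finset.mem_univ k), Lagrange.basis, bVec,
    Lagrange.nodalWeight, Lagrange.nodal, map_prod]
  simp only [Lagrange.basisDivisor, Finset.prod_mul_distrib]
  ring

theorem bVec_mul_cVec (hlam : Function.Injective lam) (k : Fin n) :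
    bVec lam k * cVec lam k = 1 := by
  have h := Lagrange.nodalWeight_ne_zero hlam.injOn (Finset.mem_univ k)
  rw [bVec, cVec]
  rw [Lagrange.nodalWeight_eq_eval_derivative_nodal (Finset.mem_univ k)] at h ⊢
  exact inv_mul_cancel₀ (fun h0 => h (by rw [h0, inv_zero]))

theorem sub_mul_xMat (hlam : Function.Injective lam) (gam : Fin n → ℂ) (k i : Fin n) :
    (lam k - lam i) * xMat lam gam k i = (if k = i then 1 else 0) - bVec lam k * cVec lam i := by
  by_cases hki : k = i
  · subst hki
    simp [bVec_mul_cVec hlam]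
  · have h := congrArg (fun p => (derivative p).eval (lam i)) (X_sub_C_mul_basis lam k)
    simp only [derivative_mul, derivative_sub, derivative_X, derivative_C, sub_zero, one_mul,
      zero_mul, zero_add, eval_add, eval_mul, eval_sub, eval_X, eval_C,
      Lagrange.eval_basis_of_ne hki (Finset.mem_univ i)] at h
    simp only [xMat, Matrix.of_apply, hki, if_false, cVec]
    linear_combination -h

theorem xMat_diag (hlam : Function.Injective lam) (gam : Fin n → ℂ) (k : Fin n) :
    xMat lam gam k k = gam k + ∑ m ∈ Finset.univ.erase k, (lam k - lam m)⁻¹ := by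
  simp only [xMat, Matrix.of_apply, if_true, Lagrange.basis, derivative_prod_finset, eval_finsetSum]
  congr 1
  refine Finset.sum_congr rfl fun m hm => ?_
  rw [eval_mul, eval_prod, Finset.prod_eq_one fun j hj => ?_, one_mul]
  · simp [Lagrange.basisDivisor]
  · have hj := (Finset.mem_erase.1 (Finset.mem_of_mem_erase hj)).1
    exact Lagrange.eval_basisDivisor_left_of_ne (hlam.ne hj.symm)

theorem X_pow_eq_sum_basis (hlam : Function.Injective lam) (b : Fin n) :
    (X : ℂ[X]) ^ b.val = ∑ i, lam i ^ b.val • Lagrange.basis Finset.univ lam i := by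
  have h := Lagrange.eq_interpolate (f := (X : ℂ[X]) ^ b.val) (s := Finset.univ) (v := lam)
    hlam.injOn (by simp)
  rw [h, Lagrange.interpolate_apply]
  simp [smul_eq_C_mul]

end Interpolation

section Reduction

variable {n : ℕ}

/-- The polynomials occurring when a block companion matrix is eliminated from the bottom. -/
noncomputable def sig (t : ℕ) (a : ℕ → ℂ) : ℕ → ℂ[X]
  | 0 => X
  | m + 1 => C (a (t - m)) - X * sig t a m

/-- The polynomial `-p(-X)`, where `p = X^(t+2) - ∑ a_k X^k`. -/
noncomputable def qPoly (t : ℕ) (a : ℕ → ℂ) : ℂ[X] := -(X * sig t a t)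

/-- The last block of a column after elimination of the other blocks. -/
noncomputable def gVec (t : ℕ) (a : ℕ → ℂ) (A : Matrix (Fin n) (Fin n) ℂ) (U : ℕ → Fin n → ℂ) :
    Fin n → ℂ :=
  U (t + 1) - ∑ j ∈ Finset.range (t + 1), (aeval A (sig t a (t - j))).mulVec (U j)

theorem gVec_apply (t : ℕ) (a : ℕ → ℂ) (A : Matrix (Fin n) (Fin n) ℂ) (U : ℕ → Fin n → ℂ)
    (k : Fin n) : gVec t a A U k = U (t + 1) k -
      ∑ p : Fin (t + 1) × Fin n, aeval A (sig t a (t - p.1.val)) k p.2 * U p.1 p.2 := by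
  rw [gVec, Pi.sub_apply, Finset.sum_apply, Fintype.sum_prod_type,
    Finset.sum_range fun j => (aeval A (sig t a (t - j))).mulVec (U j) k]
  rfl

theorem aeval_mul_self (A : Matrix (Fin n) (Fin n) ℂ) (p : ℂ[X]) :
    A * aeval A p = aeval A p * A := by
  conv_lhs => enter [1]; rw [← aeval_X (R := ℂ) A]
  rw [← map_mul, mul_comm, map_mul, aeval_X]

theorem gVec_eq (t : ℕ) (a : ℕ → ℂ) (A : Matrix (Fin n) (Fin n) ℂ) (v : ℕ → Fin n → ℂ) :
    gVec t a A (fun j => v (j + 1) + A.mulVec (v j)) =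
      v (t + 2) - ∑ k ∈ Finset.Ico 1 (t + 1), a k • v k + (aeval A (qPoly t a)).mulVec (v 0) := by
  have h1 : ∀ j ∈ Finset.range t, (aeval A (sig t a (t - j))).mulVec (v (j + 1)) +
      (aeval A (sig t a (t - (j + 1)))).mulVec (A.mulVec (v (j + 1))) = a (j + 1) • v (j + 1) := by
    intro j hj
    have hj := Finset.mem_range.1 hj
    obtain ⟨d, hd⟩ : ∃ d, t - j = d + 1 := ⟨t - j - 1, by omega⟩
    have e1 : t - (j + 1) = d := by omega
    have e2 : t - d = j + 1 := by omega
    rw [hd, e1, sig, e2, Matrix.mulVec_mulVec, ← Matrix.add_mulVec, map_sub, map_mul, aeval_X,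
      aeval_C, aeval_mul_self, sub_add_cancel]
    rw [Algebra.algebraMap_eq_smul_one, Matrix.smul_mulVec, Matrix.one_mulVec]
  have hq : (aeval A (qPoly t a)).mulVec (v 0) =
      - (aeval A (sig t a t)).mulVec (A.mulVec (v 0)) := by
    rw [Matrix.mulVec_mulVec, qPoly, map_neg, map_mul, aeval_X,
      aeval_mul_self, Matrix.neg_mulVec]
  have h0 : aeval A (sig t a 0) = A := by rw [sig, aeval_X]
  rw [gVec, hq, Finset.sum_Ico_eq_sum_range]
  simp only [Matrix.mulVec_add, Finset.sum_add_distrib, Nat.add_sub_cancel, add_comm 1]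
  rw [Finset.sum_range_succ, Finset.sum_range_succ' (fun j =>
    (aeval A (sig t a (t - j))).mulVec (A.mulVec (v j))), ← Finset.sum_congr rfl h1,
    Finset.sum_add_distrib, Nat.sub_self, h0, Nat.sub_zero]
  abel

theorem det_submatrix_equiv_equiv {I J : Type*} [Fintype I] [Fintype J] [DecidableEq I]
    [DecidableEq J] (e₁ e₂ : I ≃ J) (M : Matrix J J ℂ) :
    (M.submatrix e₁ e₂).det = Equiv.Perm.sign (e₂.trans e₁.symm) * M.det := by
  have : M.submatrix e₁ e₂ = (M.submatrix e₁ e₁).submatrix id (e₂.trans e₁.symm) := by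
    ext; simp
  rw [this, Matrix.det_permute', Matrix.det_submatrix_equiv_self]

/-- Splitting off the last block. -/
noncomputable def splitLast (n t : ℕ) :
    (Fin (t + 1) × Fin n) ⊕ (Fin n ⊕ Fin 1) ≃ (Fin (t + 2) × Fin n) ⊕ Fin 1 :=
  Equiv.ofBijective (Sum.elim (fun p => Sum.inl (p.1.castSucc, p.2))
    (Sum.map (fun k => (Fin.last _, k)) id)) <| by
    rw [Fintype.bijective_iff_injective_and_card]
    constructor
    · rintro (⟨p, k⟩ | k | k) (⟨p', k'⟩ | k' | k') h <;>
        simp_all [Fin.castSucc_ne_last, (Fin.castSucc_ne_last _).symm]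
    · simp; ring

/-- Splitting off the first block. -/
noncomputable def splitFirst (n t : ℕ) :
    (Fin (t + 1) × Fin n) ⊕ (Fin n ⊕ Fin 1) ≃ (Fin (t + 2) × Fin n) ⊕ Fin 1 :=
  Equiv.ofBijective (Sum.elim (fun p => Sum.inl (p.1.succ, p.2))
    (Sum.map (fun k => (0, k)) id)) <| by
    rw [Fintype.bijective_iff_injective_and_card]
    constructor
    · rintro (⟨p, k⟩ | k | k) (⟨p', k'⟩ | k' | k') h <;>
        simp_all [Fin.succ_ne_zero, (Fin.succ_ne_zero _).symm]
    · simp; ring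

/-- The unitriangular factor relating consecutive blocks. -/
def bidiag (t : ℕ) (A : Matrix (Fin n) (Fin n) ℂ) :
    Matrix (Fin (t + 2) × Fin n) (Fin (t + 2) × Fin n) ℂ :=
  Matrix.of fun p q => (if p = q then 1 else 0) +
    (if p.1.val = q.1.val + 1 then A p.2 q.2 else 0)

theorem det_bidiag (t : ℕ) (A : Matrix (Fin n) (Fin n) ℂ) : (bidiag t A).det = 1 := by
  have h : (bidiag t A).BlockTriangular (fun p => OrderDual.toDual p.1) := by
    intro p q hpq
    have hpq : p.1 < q.1 := hpq
    have h1 : p ≠ q := fun h => hpq.ne (congrArg Prod.fst h)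
    have h2 : p.1.val ≠ q.1.val + 1 := by omega
    simp [bidiag, h1, h2]
  rw [h.det_fintype]
  refine Finset.prod_eq_one fun k _ => ?_
  rw [← Matrix.det_one (n := {p : Fin (t + 2) × Fin n // OrderDual.toDual p.1 = k})]
  congr 1
  ext ⟨p, hp⟩ ⟨q, hq⟩
  have hpq : p.1 = q.1 := OrderDual.toDual.injective (hp.trans hq.symm)
  simp [Matrix.toSquareBlock_def, bidiag, hpq, Matrix.one_apply]

/-- Blocks obtained from solutions of the scalar equation. -/
def solBlock (t : ℕ) (A : Matrix (Fin n) (Fin n) ℂ) (W : Fin n → ℕ → Fin (t + 2) → ℂ) :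
    Matrix (Fin (t + 2) × Fin n) (Fin (t + 2) × Fin n) ℂ :=
  Matrix.of fun p q => (if p.2 = q.2 then W q.2 (p.1 + 1) q.1 else 0) + A p.2 q.2 * W q.2 p.1 q.1

theorem det_bordered_solBlock (t : ℕ) (a : ℕ → ℂ) (A : Matrix (Fin n) (Fin n) ℂ)
    (W : Fin n → ℕ → Fin (t + 2) → ℂ) (y c : Fin n → ℂ)
    (hW : ∀ i j, W i (t + 2) j = ∑ k ∈ Finset.Ico 1 (t + 1), a k * W i k j + y i * W i 0 j)
    (hdet : ∀ i, (Matrix.of fun k j : Fin (t + 2) => W i k.val j).det = 1)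
    (U : ℕ → Fin n → ℂ) (w : ℂ) :
    (Equiv.Perm.sign ((splitFirst n t).trans (splitLast n t).symm) : ℂ) *
      (Matrix.fromBlocks (solBlock t A W) (Matrix.of fun p (_ : Fin 1) => U p.1.val p.2)
        (Matrix.of fun (_ : Fin 1) q => c q.2 * W q.2 0 q.1) (Matrix.of fun _ _ => w)).det =
    (Matrix.fromBlocks (Matrix.diagonal y + aeval A (qPoly t a))
      (Matrix.of fun k (_ : Fin 1) => gVec t a A U k)
      (Matrix.of fun (_ : Fin 1) i => c i) (Matrix.of fun _ _ => w)).det := by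
  set H := Matrix.fromBlocks (solBlock t A W) (Matrix.of fun p (_ : Fin 1) => U p.1.val p.2)
        (Matrix.of fun (_ : Fin 1) q => c q.2 * W q.2 0 q.1) (Matrix.of fun _ _ => w) with hH
  set K := Matrix.fromBlocks (Matrix.diagonal y + aeval A (qPoly t a))
      (Matrix.of fun k (_ : Fin 1) => gVec t a A U k)
      (Matrix.of fun (_ : Fin 1) i => c i) (Matrix.of fun _ _ => w) with hK
  let G := bidiag t A * Matrix.blockDiagonal fun i => Matrix.of fun k j : Fin (t + 2) => W i k.val j
  have hG : G.det = 1 := by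
    rw [Matrix.det_mul, det_bidiag, Matrix.det_blockDiagonal, one_mul]
    exact Finset.prod_eq_one fun i _ => hdet i
  have hGe : ∀ p q, G p q = (if p.2 = q.2 then W q.2 p.1 q.1 else 0) +
      ∑ l : Fin (t + 2), if p.1.val = l.val + 1 then A p.2 q.2 * W q.2 l q.1 else 0 := by
    intro p q
    have h2 : ∀ l : Fin (t + 2), ∑ m, (if p.1.val = l.val + 1 then A p.2 m else 0) *
        (if m = q.2 then W m l q.1 else 0) =
        if p.1.val = l.val + 1 then A p.2 q.2 * W q.2 l q.1 else 0 := by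
      intro l
      simp
    simp only [G, Matrix.mul_apply, bidiag, Matrix.of_apply, add_mul, Finset.sum_add_distrib,
      Matrix.blockDiagonal_apply]
    congr 1
    · simp only [ite_mul, one_mul, zero_mul, Finset.sum_ite_eq, Finset.mem_univ, if_true]
      split_ifs with h
      · rw [h]
      · rfl
    · rw [Fintype.sum_prod_type]
      exact Finset.sum_congr rfl fun l _ => h2 l
  have hG0 : ∀ k q, G (0, k) q = if k = q.2 then W q.2 0 q.1 else 0 := by
    intro k q
    rw [hGe, Finset.sum_eq_zero fun l _ => by simp]
    simp
  have hGs : ∀ (p : Fin (t + 1)) k q, G (p.succ, k) q = solBlock t A W (p.castSucc, k) q := by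
    intro p k q
    rw [hGe, Finset.sum_eq_single p.castSucc]
    · simp [solBlock]
    · intro l _ hl
      have : l.val ≠ p.val := fun h => hl (Fin.ext h)
      rw [if_neg]
      simp only [Fin.val_succ]
      omega
    · simp
  let Mid : Matrix ((Fin (t + 1) × Fin n) ⊕ (Fin n ⊕ Fin 1))
      ((Fin (t + 1) × Fin n) ⊕ (Fin n ⊕ Fin 1)) ℂ :=
    Matrix.fromBlocks 1 (Matrix.of fun p => Sum.elim 0 (fun _ => U p.1.val p.2)) 0 K
  let Low : Matrix ((Fin (t + 1) × Fin n) ⊕ (Fin n ⊕ Fin 1))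
      ((Fin (t + 1) × Fin n) ⊕ (Fin n ⊕ Fin 1)) ℂ :=
    Matrix.fromBlocks 1 0 (Matrix.of fun s p =>
      Sum.elim (fun k => aeval A (sig t a (t - p.1.val)) k p.2) 0 s) 1
  have hsub : H.submatrix (splitLast n t) (splitFirst n t) =
      Low * (Mid * (Matrix.fromBlocks G 0 0 1).submatrix (splitFirst n t) (splitFirst n t)) := by
    have hM1 : ∀ p s, (Mid * (Matrix.fromBlocks G 0 0 1).submatrix (splitFirst n t)
        (splitFirst n t)) (Sum.inl p) s =
        H (Sum.inl (p.1.castSucc, p.2)) (splitFirst n t s) := by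
      rintro ⟨p, k⟩ s
      simp only [Matrix.mul_apply, Fintype.sum_sum_type, Mid, Matrix.fromBlocks_apply₁₁,
        Matrix.fromBlocks_apply₁₂, Matrix.of_apply, Sum.elim_inl, Sum.elim_inr, Pi.zero_apply,
        zero_mul, Finset.sum_const_zero, zero_add, Matrix.submatrix_apply, Matrix.one_apply,
        ite_mul, one_mul, Finset.sum_ite_eq, Finset.mem_univ, if_true, splitFirst,
        Equiv.ofBijective_apply, Sum.map_inr, id]
      rcases s with ⟨p', k'⟩ | k' | k'
      · simp [hGs, hH]
      · simp [hGs, hH]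
      · obtain rfl := Subsingleton.elim k' 0
        simp [hH]
    have hM2 : ∀ k s, (Mid * (Matrix.fromBlocks G 0 0 1).submatrix (splitFirst n t)
        (splitFirst n t)) (Sum.inr k) s =
        ∑ l, K k (Sum.inl l) *
            (Matrix.fromBlocks G 0 0 (1 : Matrix (Fin 1) (Fin 1) ℂ)) (Sum.inl (0, l))
              (splitFirst n t s) +
          K k (Sum.inr 0) * (Matrix.fromBlocks G 0 0 (1 : Matrix (Fin 1) (Fin 1) ℂ)) (Sum.inr 0)
            (splitFirst n t s) := by
      rintro k s
      simp [Matrix.mul_apply, Fintype.sum_sum_type, Mid, splitFirst]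
    ext i s
    rw [Matrix.mul_apply, Fintype.sum_sum_type, Matrix.submatrix_apply]
    simp only [hM1, hM2]
    generalize splitFirst n t s = q
    rcases i with p | k | k
    · simp [Low, splitLast, Matrix.one_apply]
    · simp only [Low, Matrix.fromBlocks_apply₂₁, Matrix.fromBlocks_apply₂₂, Matrix.of_apply,
        Sum.elim_inl, Matrix.one_apply, ite_mul, one_mul, zero_mul, Finset.sum_ite_eq,
        Finset.mem_univ, if_true, splitLast, Equiv.ofBijective_apply, Sum.map_inl, Sum.elim_inr]
      rcases q with q | q
      · have key := congrFun (gVec_eq t a A fun m l => if l = q.2 then W q.2 m q.1 else 0) k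
        have hv : ∀ m l, A.mulVec (fun l => if l = q.2 then W q.2 m q.1 else 0) l =
            A l q.2 * W q.2 m q.1 := fun m l => by simp [Matrix.mulVec, dotProduct]
        rw [gVec_apply] at key
        simp only [Pi.add_apply, hv] at key
        have hB : ∀ p : Fin (t + 1) × Fin n, H (Sum.inl (p.1.castSucc, p.2)) (Sum.inl q) =
            (if p.2 = q.2 then W q.2 (p.1 + 1) q.1 else 0) + A p.2 q.2 * W q.2 p.1 q.1 :=
          fun p => rfl
        have hC : H (Sum.inl (Fin.last (t + 1), k)) (Sum.inl q) =
            (if k = q.2 then W q.2 (t + 2) q.1 else 0) + A k q.2 * W q.2 (t + 1) q.1 := rfl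
        rw [hC, sub_eq_iff_eq_add.1 key]
        simp only [hB, hK, Matrix.fromBlocks_apply₁₁, Matrix.fromBlocks_apply₁₂,
          Matrix.fromBlocks_apply₂₁, Matrix.zero_apply, mul_zero, add_zero, hG0, hW]
        rw [add_comm]
        congr 1
        simp only [Matrix.mulVec, dotProduct, mul_ite, mul_zero, Finset.sum_ite_eq',
          Finset.mem_univ, if_true, Matrix.add_apply, add_mul, Pi.sub_apply, Finset.sum_apply,
          Pi.smul_apply, smul_eq_mul, Matrix.diagonal_apply]
        split_ifs with hk
        · rw [hk]
          ring
        · simp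
      · obtain rfl := Subsingleton.elim q 0
        have hB : ∀ p : Fin (t + 1) × Fin n, H (Sum.inl (p.1.castSucc, p.2)) (Sum.inr 0) =
            U p.1 p.2 := fun p => rfl
        have hC : H (Sum.inl (Fin.last (t + 1), k)) (Sum.inr 0) = U (t + 1) k := rfl
        rw [hC]
        simp only [hB, hK, Matrix.fromBlocks_apply₁₂, Matrix.fromBlocks_apply₂₂, gVec_apply,
          Matrix.of_apply, Matrix.one_apply, Matrix.zero_apply, if_true]
        simp
    · obtain rfl := Subsingleton.elim k 0
      rcases q with q | q
      · simp [Low, splitLast, hK, hH, hG0, Matrix.one_apply]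
      · obtain rfl := Subsingleton.elim q 0
        simp [Low, splitLast, hK, hH, Matrix.one_apply]
  have h := congrArg Matrix.det hsub
  rw [det_submatrix_equiv_equiv, Matrix.det_mul, Matrix.det_mul, Matrix.det_submatrix_equiv_self,
    Matrix.det_fromBlocks_zero₂₁, Matrix.det_fromBlocks_zero₂₁ G, hG,
    Matrix.det_fromBlocks_zero₁₂] at h
  simpa only [Matrix.det_one, one_mul, mul_one] using h

end Reduction

section Wronskian

variable {n t : ℕ} {a : ℕ → ℂ} {F : Fin (t + 2) → Entire} {lam : Fin n → ℂ}

/-- The functions `φ_{i,j}`, indexed by pairs `(j, i)`. -/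
noncomputable def phi (F : Fin (t + 2) → Entire) (lam gam : Fin n → ℂ) (q : Fin (t + 2) × Fin n) :
    Entire :=
  gam q.2 • shift (lam q.2) (F q.1) + dOp (shift (lam q.2) (F q.1))

/-- The values at `x` of the derivatives of `ℓ_k(L) u`, for the Lagrange basis `ℓ_k` at `λ`. -/
noncomputable def basisJet (t : ℕ) (a : ℕ → ℂ) (lam : Fin n → ℂ) (u : Entire) (x : ℂ) :
    ℕ → Fin n → ℂ :=
  fun j k => ((dOp ^ j) (aeval (airyEnd (t + 2) a) (Lagrange.basis Finset.univ lam k) u)).1 x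

/-- The value at `x` of `p(L) u`, for the nodal polynomial `p` of `λ`. -/
noncomputable def nodalVal (t : ℕ) (a : ℕ → ℂ) (lam : Fin n → ℂ) (u : Entire) (x : ℂ) : ℂ :=
  (aeval (airyEnd (t + 2) a) (Lagrange.nodal Finset.univ lam) u).1 x

theorem dOp_pow_airyEnd_pow_apply (hlam : Function.Injective lam) (u : Entire) (x : ℂ) (j : ℕ)
    (b : Fin n) : ((dOp ^ j) ((airyEnd (t + 2) a ^ b.val) u)).1 x =
      ∑ i, lam i ^ b.val * basisJet t a lam u x j i := by
  rw [← aeval_X (R := ℂ) (airyEnd (t + 2) a), ← map_pow, X_pow_eq_sum_basis hlam b]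
  simp only [map_sum, map_smul, LinearMap.sum_apply, LinearMap.smul_apply, sum_apply, smul_apply,
    basisJet]

theorem basisJet_phi (hF : ∀ j, airyEnd (t + 2) a (F j) = 0) (hlam : Function.Injective lam)
    (gam : Fin n → ℂ) (x : ℂ) (p q : Fin (t + 2) × Fin n) :
    basisJet t a lam (phi F lam gam q) x p.1 p.2 = solBlock t (xMat lam gam)
      (fun i m j => iteratedDeriv m (F j).1 (x + lam i)) p q := by
  obtain ⟨h1, h2⟩ := aeval_apply_of_commutator (airyEnd_dOp (t + 2) a)
    (airyEnd_shift (t + 2) a (F q.1) (hF q.1) (lam q.2)) (Lagrange.basis Finset.univ lam p.2)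
  have h3 : (Lagrange.basis Finset.univ lam p.2).eval (lam q.2) = if p.2 = q.2 then 1 else 0 := by
    split_ifs with h
    · rw [h, Lagrange.eval_basis_self hlam.injOn (Finset.mem_univ _)]
    · exact Lagrange.eval_basis_of_ne h (Finset.mem_univ _)
  have h4 : (dOp ^ p.1.val) (dOp (shift (lam q.2) (F q.1))) =
      (dOp ^ (p.1.val + 1)) (shift (lam q.2) (F q.1)) := by rw [pow_succ]; rfl
  rw [basisJet, phi, map_add, map_smul, h1, h2, h3]
  simp only [map_add, map_smul, add_apply, smul_apply, h4, dOp_pow_shift, dOp_pow_apply, solBlock,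
    Matrix.of_apply, xMat]
  split_ifs <;> ring

theorem nodalVal_phi (hF : ∀ j, airyEnd (t + 2) a (F j) = 0) (gam : Fin n → ℂ) (x : ℂ)
    (q : Fin (t + 2) × Fin n) :
    nodalVal t a lam (phi F lam gam q) x = cVec lam q.2 * (F q.1).1 (x + lam q.2) := by
  obtain ⟨h1, h2⟩ := aeval_apply_of_commutator (airyEnd_dOp (t + 2) a)
    (airyEnd_shift (t + 2) a (F q.1) (hF q.1) (lam q.2)) (Lagrange.nodal Finset.univ lam)
  have h3 : (Lagrange.nodal Finset.univ lam).eval (lam q.2) = 0 :=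
    Lagrange.eval_nodal_at_node (Finset.mem_univ _)
  rw [nodalVal, phi, map_add, map_smul, h1, h2, h3, cVec]
  rw [zero_smul, zero_smul, smul_zero, zero_add, zero_add, smul_apply]
  rfl

/-- The enumeration of the functions `φ_{i,j}`. -/
def colEquiv (n t : ℕ) : Fin ((t + 2) * n) ≃ Fin (t + 2) × Fin n :=
  (finCongr (mul_comm (t + 2) n)).trans (finProdFinEquiv.symm.trans (Equiv.prodComm _ _))

theorem colEquiv_fst (k : Fin ((t + 2) * n)) : (colEquiv n t k).1.val = k.val % (t + 2) := rfl

theorem colEquiv_snd (k : Fin ((t + 2) * n)) : (colEquiv n t k).2.val = k.val / (t + 2) := rfl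

/-- The enumeration of the functions `φ_{i,j}` and of one further function. -/
def colEquivB (n t : ℕ) : Fin ((t + 2) * n + 1) ≃ (Fin (t + 2) × Fin n) ⊕ Fin 1 :=
  finSumFinEquiv.symm.trans (Equiv.sumCongr (colEquiv n t) (Equiv.refl _))

theorem colEquivB_castSucc (k : Fin ((t + 2) * n)) :
    colEquivB n t k.castSucc = Sum.inl (colEquiv n t k) := by
  have : k.castSucc = Fin.castAdd 1 k := rfl
  simp [colEquivB, this]

theorem colEquivB_last : colEquivB n t (Fin.last _) = Sum.inr 0 := by
  have : Fin.last ((t + 2) * n) = Fin.natAdd _ (0 : Fin 1) := rfl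
  simp only [colEquivB, Equiv.trans_apply, this, finSumFinEquiv_symm_apply_natAdd]
  rfl

theorem isMonicOp_dOp_pow_mul_airyEnd_pow (t : ℕ) (a : ℕ → ℂ) (k : ℕ) :
    IsMonicOp k (dOp ^ (k % (t + 2)) * airyEnd (t + 2) a ^ (k / (t + 2))) := by
  have := (isMonicOp_airyEnd_pow (r := t + 2) (by omega) a (k / (t + 2))).dOp_pow_mul (k % (t + 2))
  rwa [Nat.div_add_mod] at this

open scoped Kronecker in
/-- The change of basis from powers of `L` to the operators `ℓ_k(L)`. -/
noncomputable def powBasis (t : ℕ) (lam : Fin n → ℂ) :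
    Matrix (Fin (t + 2) × Fin n) (Fin (t + 2) × Fin n) ℂ :=
  (1 : Matrix (Fin (t + 2)) (Fin (t + 2)) ℂ) ⊗ₖ (Matrix.vandermonde lam).transpose

theorem det_powBasis_ne_zero (hlam : Function.Injective lam) : (powBasis t lam).det ≠ 0 := by
  rw [powBasis, Matrix.det_kronecker, Matrix.det_one, one_pow, one_mul, Matrix.det_transpose]
  exact pow_ne_zero _ (Matrix.det_vandermonde_ne_zero_iff.2 hlam)

theorem sum_powBasis_mul (hlam : Function.Injective lam) (u : Entire) (x : ℂ)
    (p : Fin (t + 2) × Fin n) :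
    ∑ q, powBasis t lam p q * basisJet t a lam u x q.1 q.2 =
      ((dOp ^ p.1.val) ((airyEnd (t + 2) a ^ p.2.val) u)).1 x := by
  rw [dOp_pow_airyEnd_pow_apply hlam, Fintype.sum_prod_type, Finset.sum_eq_single p.1]
  · simp [powBasis, Matrix.vandermonde]
  · intro b _ hb
    refine Finset.sum_eq_zero fun i _ => ?_
    simp [powBasis, hb.symm]
  · simp

theorem wrDet_phi (hF : ∀ j, airyEnd (t + 2) a (F j) = 0) (hlam : Function.Injective lam)
    (gam : Fin n → ℂ) (x : ℂ) :
    wrDet ((t + 2) * n) (fun s => (phi F lam gam (colEquiv n t s)).1) x =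
      (powBasis t lam).det * (solBlock t (xMat lam gam)
        (fun i m j => iteratedDeriv m (F j).1 (x + lam i))).det := by
  rw [wrDet_eq_det _ _ _ (fun k => isMonicOp_dOp_pow_mul_airyEnd_pow t a k.val), ← Matrix.det_mul,
    ← Matrix.det_submatrix_equiv_self (colEquiv n t)]
  congr 1
  ext k s
  rw [Matrix.submatrix_apply, Matrix.mul_apply]
  simp only [← basisJet_phi hF hlam]
  rw [sum_powBasis_mul hlam]
  rfl

theorem wrDetB_phi (hF : ∀ j, airyEnd (t + 2) a (F j) = 0) (hlam : Function.Injective lam)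
    (gam : Fin n → ℂ) (u : Entire) (x : ℂ) :
    wrDetB ((t + 2) * n) (fun s => (phi F lam gam (colEquiv n t s)).1) u.1 x =
      (powBasis t lam).det * (Matrix.fromBlocks (solBlock t (xMat lam gam)
        (fun i m j => iteratedDeriv m (F j).1 (x + lam i)))
        (Matrix.of fun p (_ : Fin 1) => basisJet t a lam u x p.1.val p.2)
        (Matrix.of fun (_ : Fin 1) q => cVec lam q.2 * (F q.1).1 (x + lam q.2))
        (Matrix.of fun _ _ => nodalVal t a lam u x)).det := by
  let g : Fin ((t + 2) * n + 1) → Entire :=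
    fun s => Sum.elim (phi F lam gam) (fun _ => u) (colEquivB n t s)
  let P : Fin ((t + 2) * n + 1) → Module.End ℂ Entire := fun k =>
    Sum.elim (fun p => dOp ^ p.1.val * airyEnd (t + 2) a ^ p.2.val)
      (fun _ => aeval (airyEnd (t + 2) a) (Lagrange.nodal Finset.univ lam)) (colEquivB n t k)
  have hP : ∀ k, IsMonicOp k.val (P k) := by
    intro k
    induction k using Fin.lastCases with
    | last =>
      have := isMonicOp_aeval (r := t + 2) (by omega) a
        (Lagrange.nodal_monic (s := Finset.univ) (v := lam))
      rw [Lagrange.natDegree_nodal, Finset.card_fin] at this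
      simpa [P, colEquivB_last] using this
    | cast k =>
      simpa [P, colEquivB_castSucc, colEquiv_fst, colEquiv_snd] using
        isMonicOp_dOp_pow_mul_airyEnd_pow t a k.val
  have hg : (Fin.snoc (fun s => (phi F lam gam (colEquiv n t s)).1) u.1 :
      Fin ((t + 2) * n + 1) → ℂ → ℂ) = fun s => (g s).1 := by
    funext s
    induction s using Fin.lastCases with
    | last => simp [g, colEquivB_last]
    | cast s => simp [g, colEquivB_castSucc]
  have hK : (powBasis t lam).det = (Matrix.fromBlocks (powBasis t lam) 0 0
      (1 : Matrix (Fin 1) (Fin 1) ℂ)).det := by simp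
  rw [wrDetB, hg, wrDet_eq_det _ g P hP, hK, ← Matrix.det_mul,
    ← Matrix.det_submatrix_equiv_self (colEquivB n t), Matrix.fromBlocks_multiply]
  congr 1
  ext k s
  rw [Matrix.of_apply, Matrix.submatrix_apply]
  simp only [g, P]
  rcases colEquivB n t k with p | p <;> rcases colEquivB n t s with q | q
  · simp only [Sum.elim_inl, Matrix.fromBlocks_apply₁₁, Matrix.add_apply, Matrix.mul_apply,
      Matrix.zero_apply, zero_mul, Finset.sum_const_zero, add_zero, ← basisJet_phi hF hlam]
    rw [sum_powBasis_mul hlam]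
    rfl
  · simp only [Sum.elim_inl, Sum.elim_inr, Matrix.fromBlocks_apply₁₂, Matrix.add_apply,
      Matrix.mul_apply, Matrix.zero_apply, zero_mul, Finset.sum_const_zero, add_zero,
      Matrix.of_apply]
    rw [sum_powBasis_mul hlam]
    rfl
  · simp only [Sum.elim_inl, Sum.elim_inr, Matrix.fromBlocks_apply₂₁, Matrix.zero_mul,
      Matrix.one_mul, zero_add, Matrix.of_apply, ← nodalVal_phi hF gam]
    rfl
  · simp only [Sum.elim_inr, Matrix.fromBlocks_apply₂₂, Matrix.zero_mul, Matrix.one_mul, zero_add,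
      Matrix.of_apply]
    rfl

/-- The second Calogero–Moser matrix. -/
noncomputable def yMat (t : ℕ) (a : ℕ → ℂ) (lam gam : Fin n → ℂ) : Matrix (Fin n) (Fin n) ℂ :=
  Matrix.diagonal lam + aeval (xMat lam gam) (qPoly t a)

theorem exists_wronskian_formula (hF : ∀ j, airyEnd (t + 2) a (F j) = 0)
    (hwr : ∀ x, wrDet (t + 2) (fun j => (F j).1) x = 1) (hlam : Function.Injective lam)
    (gam : Fin n → ℂ) : ∃ κ : ℂ, κ ≠ 0 ∧
    (∀ x, wrDet ((t + 2) * n) (fun s => (phi F lam gam (colEquiv n t s)).1) x =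
      κ * (x • (1 : Matrix (Fin n) (Fin n) ℂ) + yMat t a lam gam).det) ∧
    ∀ (u : Entire) (x : ℂ),
      wrDetB ((t + 2) * n) (fun s => (phi F lam gam (colEquiv n t s)).1) u.1 x =
      κ * (Matrix.fromBlocks (x • 1 + yMat t a lam gam)
        (Matrix.of fun k (_ : Fin 1) => gVec t a (xMat lam gam) (basisJet t a lam u x) k)
        (Matrix.of fun (_ : Fin 1) i => cVec lam i)
        (Matrix.of fun _ _ => nodalVal t a lam u x)).det := by
  set σ : ℤˣ := Equiv.Perm.sign ((splitFirst n t).trans (splitLast n t).symm) with hσ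
  have hσσ : ((σ : ℤ) : ℂ) * ((σ : ℤ) : ℂ) = 1 := by
    rcases Int.units_eq_one_or σ with h | h <;> simp [h]
  have hW : ∀ (x : ℂ) (i : Fin n) (j : Fin (t + 2)), iteratedDeriv (t + 2) (F j).1 (x + lam i) =
      ∑ k ∈ Finset.Ico 1 (t + 1), a k * iteratedDeriv k (F j).1 (x + lam i) +
        (x + lam i) * iteratedDeriv 0 (F j).1 (x + lam i) := by
    intro x i j
    have h := airyEnd_apply (t + 2) a (F j) (x + lam i)
    rw [hF j] at h
    have h0 : (0 : Entire).1 (x + lam i) = 0 := rfl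
    rw [h0, airyOp, show t + 2 - 1 = t + 1 from rfl] at h
    rw [iteratedDeriv_zero]
    linear_combination -h
  have hdet : ∀ (x : ℂ) (i : Fin n),
      (Matrix.of fun k j : Fin (t + 2) => iteratedDeriv k.val (F j).1 (x + lam i)).det = 1 :=
    fun x i => hwr (x + lam i)
  have hmain := fun x => det_bordered_solBlock t a (xMat lam gam)
    (fun i m j => iteratedDeriv m (F j).1 (x + lam i)) (fun i => x + lam i) (cVec lam)
    (hW x) (hdet x)
  have hY : ∀ x : ℂ, Matrix.diagonal (fun i => x + lam i) + aeval (xMat lam gam) (qPoly t a) =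
      x • 1 + yMat t a lam gam := by
    intro x
    rw [yMat, ← add_assoc, Matrix.smul_one_eq_diagonal, Matrix.diagonal_add]
  refine ⟨(powBasis t lam).det * σ, mul_ne_zero (det_powBasis_ne_zero hlam) ?_,
    fun x => ?_, fun u x => ?_⟩
  · exact left_ne_zero_of_mul (hσσ.symm ▸ one_ne_zero)
  · have h := hmain x (fun _ _ => 0) 1
    have hg : gVec t a (xMat lam gam) (fun _ _ => 0) = 0 := by
      funext k
      simp [gVec_apply]
    have z1 : (Matrix.of fun (p : Fin (t + 2) × Fin n) (_ : Fin 1) => (0 : ℂ)) = 0 := rfl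
    have z2 : (Matrix.of fun (p : Fin n) (_ : Fin 1) => (0 : Fin n → ℂ) p) = 0 := rfl
    have z3 : (Matrix.of fun (_ _ : Fin 1) => (1 : ℂ)).det = 1 := by simp
    rw [hg, z1, z2, Matrix.det_fromBlocks_zero₁₂, Matrix.det_fromBlocks_zero₁₂, z3, mul_one,
      mul_one, hY] at h
    rw [wrDet_phi hF hlam, ← h]
    linear_combination -(powBasis t lam).det * (solBlock t (xMat lam gam)
        (fun i m j => iteratedDeriv m (F j).1 (x + lam i))).det * hσσ
  · have h := hmain x (basisJet t a lam u x) (nodalVal t a lam u x)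
    rw [hY] at h
    rw [wrDetB_phi hF hlam, ← h]
    simp only [iteratedDeriv_zero]
    linear_combination -(powBasis t lam).det * (Matrix.fromBlocks (solBlock t (xMat lam gam)
        (fun i m j => iteratedDeriv m (F j).1 (x + lam i)))
        (Matrix.of fun p (_ : Fin 1) => basisJet t a lam u x p.1.val p.2)
        (Matrix.of fun (_ : Fin 1) q => cVec lam q.2 * (F q.1).1 (x + lam q.2))
        (Matrix.of fun _ _ => nodalVal t a lam u x)).det * hσσ

end Wronskian

section Bordered

variable {n : ℕ}

open Matrix in
theorem det_bordered_diagonal_of_ne_zero (d g c : Fin n → ℂ) (w : ℂ) (hd : ∀ k, d k ≠ 0) :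
    (fromBlocks (diagonal d) (of fun k (_ : Fin 1) => g k) (of fun (_ : Fin 1) i => c i)
      (of fun _ _ => w)).det =
    (∏ m, d m) * w - ∑ k, (∏ m ∈ Finset.univ.erase k, d m) * (c k * g k) := by
  have h : (fromBlocks (diagonal d) (of fun k (_ : Fin 1) => g k) (of fun (_ : Fin 1) i => c i)
      (of fun _ _ => w)) * (fromBlocks 1 (of fun k (_ : Fin 1) => -((d k)⁻¹ * g k)) 0 1) =
      fromBlocks (diagonal d) 0 (of fun (_ : Fin 1) i => c i)
        (of fun _ _ => w - ∑ k, c k * ((d k)⁻¹ * g k)) := by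
    rw [fromBlocks_multiply]
    congr 1
    · simp
    · ext k _
      simp [diagonal_mul, mul_inv_cancel_left₀ (hd k)]
    · simp
    · ext _ _
      simp [mul_apply]
      ring
  have h := congrArg Matrix.det h
  rw [det_mul, det_fromBlocks_zero₂₁, det_one, det_one, mul_one, mul_one, det_fromBlocks_zero₁₂,
    det_diagonal] at h
  rw [h, det_unique, of_apply, mul_sub, Finset.mul_sum]
  refine congrArg _ (Finset.sum_congr rfl fun k _ => ?_)
  rw [← Finset.mul_prod_erase Finset.univ d (Finset.mem_univ k)]
  field_simp [hd k]

open Matrix in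
theorem det_bordered_diagonal (d g c : Fin n → ℂ) (w : ℂ) :
    (fromBlocks (diagonal d) (of fun k (_ : Fin 1) => g k) (of fun (_ : Fin 1) i => c i)
      (of fun _ _ => w)).det =
    (∏ m, d m) * w - ∑ k, (∏ m ∈ Finset.univ.erase k, d m) * (c k * g k) := by
  have hdense : Dense (Set.range fun k => -d k)ᶜ :=
    (Set.finite_range _).countable.dense_compl ℂ
  have h : (fun ε : ℂ => (fromBlocks (diagonal fun k => ε + d k) (of fun k (_ : Fin 1) => g k)
      (of fun (_ : Fin 1) i => c i) (of fun _ _ => w)).det) = fun ε => (∏ m, (ε + d m)) * w -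
        ∑ k, (∏ m ∈ Finset.univ.erase k, (ε + d m)) * (c k * g k) := by
    refine Continuous.ext_on hdense ?_ ?_ fun ε hε => ?_
    · refine Continuous.matrix_det (Continuous.matrix_fromBlocks
        (Continuous.matrix_diagonal ?_) continuous_const continuous_const continuous_const)
      fun_prop
    · fun_prop
    · exact det_bordered_diagonal_of_ne_zero _ g c w
        fun k hk => hε ⟨k, (eq_neg_of_add_eq_zero_left hk).symm⟩
  simpa using congrFun h 0

open Matrix in
theorem det_bordered_of_conj {A S T : Matrix (Fin n) (Fin n) ℂ} {d : Fin n → ℂ} (hTS : T * S = 1)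
    (hA : A * S = S * diagonal d) (g c : Fin n → ℂ) (w : ℂ) :
    (fromBlocks A (of fun k (_ : Fin 1) => g k) (of fun (_ : Fin 1) i => c i)
      (of fun _ _ => w)).det =
    (∏ m, d m) * w -
      ∑ k, (∏ m ∈ Finset.univ.erase k, d m) * (vecMul c S k * (T.mulVec g) k) := by
  have h : fromBlocks T 0 0 (1 : Matrix (Fin 1) (Fin 1) ℂ) * fromBlocks A
      (of fun k (_ : Fin 1) => g k) (of fun (_ : Fin 1) i => c i) (of fun _ _ => w) *
      fromBlocks S 0 0 (1 : Matrix (Fin 1) (Fin 1) ℂ) =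
      fromBlocks (diagonal d) (of fun k (_ : Fin 1) => (T.mulVec g) k)
        (of fun (_ : Fin 1) i => vecMul c S i) (of fun _ _ => w) := by
    simp only [fromBlocks_multiply, Matrix.zero_mul, Matrix.mul_zero, add_zero, zero_add,
      Matrix.one_mul, Matrix.mul_one]
    rw [Matrix.mul_assoc T, hA, ← Matrix.mul_assoc, hTS, Matrix.one_mul]
    rfl
  rw [← det_bordered_diagonal, ← h, det_mul, det_mul, det_fromBlocks_zero₁₂,
    det_fromBlocks_zero₁₂, det_one, mul_one, mul_one, mul_right_comm, ← det_mul, hTS, det_one,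
    one_mul]

end Bordered

section Jet

variable {n t : ℕ} {a : ℕ → ℂ}

theorem gVec_add (A : Matrix (Fin n) (Fin n) ℂ) (U V : ℕ → Fin n → ℂ) :
    gVec t a A (fun j => U j + V j) = gVec t a A U + gVec t a A V := by
  simp only [gVec, Matrix.mulVec_add, Finset.sum_add_distrib]
  abel

theorem gVec_mulVec (A : Matrix (Fin n) (Fin n) ℂ) (U : ℕ → Fin n → ℂ) :
    gVec t a A (fun j => A.mulVec (U j)) = A.mulVec (gVec t a A U) := by
  simp only [gVec, Matrix.mulVec_sub, Matrix.mulVec_sum, Matrix.mulVec_mulVec, aeval_mul_self]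

theorem hasDerivAt_basisJet (lam : Fin n → ℂ) (u : Entire) (x : ℂ) (j : ℕ) (k : Fin n) :
    HasDerivAt (fun x => basisJet t a lam u x j k) (basisJet t a lam u x (j + 1) k) x := by
  have h : ∀ v : Entire, ((dOp ^ (j + 1)) v).1 x = deriv ((dOp ^ j) v).1 x := fun v => by
    rw [pow_succ']
    rfl
  rw [basisJet, h]
  exact (((dOp ^ j) _).2 x).hasDerivAt

theorem hasDerivAt_gVec (A : Matrix (Fin n) (Fin n) ℂ) (lam : Fin n → ℂ) (u : Entire) (x : ℂ)
    (k : Fin n) : HasDerivAt (fun x => gVec t a A (basisJet t a lam u x) k)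
      (gVec t a A (fun j => basisJet t a lam u x (j + 1)) k) x := by
  simp only [gVec_apply]
  exact (hasDerivAt_basisJet lam u x _ k).sub
    (HasDerivAt.fun_sum fun p _ => (hasDerivAt_basisJet lam u x _ _).const_mul _)

theorem basisJet_sub_sum (lam : Fin n → ℂ) (u : Entire) (x : ℂ) :
    basisJet t a lam u x (t + 2) - ∑ k ∈ Finset.Ico 1 (t + 1), a k • basisJet t a lam u x k =
      (fun k => (x + lam k) * basisJet t a lam u x 0 k) + nodalVal t a lam u x • bVec lam := by
  funext k
  set v := aeval (airyEnd (t + 2) a) (Lagrange.basis Finset.univ lam k) u with hv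
  have h1 : airyEnd (t + 2) a v = lam k • v +
      bVec lam k • aeval (airyEnd (t + 2) a) (Lagrange.nodal Finset.univ lam) u := by
    have h := congrArg (fun p => aeval (airyEnd (t + 2) a) p u) (X_sub_C_mul_basis lam k)
    simp only [map_mul, map_sub, aeval_X, aeval_C, Module.End.mul_apply, LinearMap.sub_apply,
      Module.algebraMap_end_apply, ← hv] at h
    rw [← h]
    abel
  have h2 := airyEnd_apply (t + 2) a v x
  rw [h1, airyOp, show t + 2 - 1 = t + 1 from rfl, add_apply, smul_apply, smul_apply] at h2
  simp only [Pi.sub_apply, Finset.sum_apply, Pi.smul_apply, Pi.add_apply, smul_eq_mul, basisJet,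
    dOp_pow_apply, nodalVal, ← hv, iteratedDeriv_zero]
  linear_combination -h2

theorem mulVec_gVec_add (lam gam : Fin n → ℂ) (u : Entire) (x : ℂ) :
    (xMat lam gam).mulVec (gVec t a (xMat lam gam) (basisJet t a lam u x)) +
      gVec t a (xMat lam gam) (fun j => basisJet t a lam u x (j + 1)) =
    x • basisJet t a lam u x 0 + (yMat t a lam gam).mulVec (basisJet t a lam u x 0) +
      nodalVal t a lam u x • bVec lam := by
  rw [← gVec_mulVec, add_comm, ← gVec_add, gVec_eq, basisJet_sub_sum, yMat, Matrix.add_mulVec]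
  funext k
  simp only [Pi.add_apply, Pi.smul_apply, Matrix.mulVec_diagonal, smul_eq_mul]
  ring

end Jet

section Spectral

variable {n t : ℕ} {a : ℕ → ℂ} {lam gam mu : Fin n → ℂ} {S T X' : Matrix (Fin n) (Fin n) ℂ}

open Matrix in
theorem yMat_commutator (t : ℕ) (a : ℕ → ℂ) (hlam : Function.Injective lam) (gam : Fin n → ℂ) :
    yMat t a lam gam * xMat lam gam - xMat lam gam * yMat t a lam gam =
      1 - vecMulVec (bVec lam) (cVec lam) := by
  rw [yMat, add_mul, mul_add, aeval_mul_self, add_sub_add_right_eq_sub]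
  ext k i
  rw [Matrix.sub_apply, diagonal_mul, mul_diagonal, Matrix.sub_apply, one_apply, vecMulVec_apply,
    ← sub_mul_xMat hlam gam]
  ring

open Matrix in
theorem sub_mul_conj (hlam : Function.Injective lam) (hTS : T * S = 1)
    (hYS : yMat t a lam gam * S = -(S * diagonal mu)) (hX : xMat lam gam * S = S * X')
    (k i : Fin n) : (mu k - mu i) * X' k i =
      T.mulVec (bVec lam) k * vecMul (cVec lam) S i - if k = i then 1 else 0 := by
  have hTY : T * yMat t a lam gam = -(diagonal mu * T) := by
    have h : S * T = 1 := mul_eq_one_comm.1 hTS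
    have := congrArg (fun M => T * M * T) hYS
    simp only [Matrix.mul_neg, Matrix.neg_mul] at this
    rwa [Matrix.mul_assoc, Matrix.mul_assoc, h, Matrix.mul_one, ← Matrix.mul_assoc T S, hTS,
      Matrix.one_mul] at this
  have h := congrArg (fun M => T * M * S) (yMat_commutator t a hlam gam)
  simp only [Matrix.mul_sub, Matrix.sub_mul, Matrix.mul_one, hTS, mul_vecMulVec,
    vecMulVec_mul] at h
  rw [← Matrix.mul_assoc T (yMat t a lam gam), hTY, Matrix.neg_mul, Matrix.neg_mul,
    Matrix.mul_assoc (diagonal mu * T), hX, Matrix.mul_assoc (diagonal mu), ← Matrix.mul_assoc T S,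
    hTS, Matrix.one_mul, Matrix.mul_assoc T, Matrix.mul_assoc (xMat lam gam), hYS, Matrix.mul_neg,
    Matrix.mul_neg, ← Matrix.mul_assoc (xMat lam gam), hX, Matrix.mul_assoc S,
    ← Matrix.mul_assoc T S, hTS, Matrix.one_mul] at h
  have h := congrFun (congrFun h k) i
  simp only [Matrix.sub_apply, Matrix.neg_apply, diagonal_mul, mul_diagonal, one_apply,
    vecMulVec_apply] at h
  linear_combination -h

open Matrix in
theorem smul_one_add_mul_of_conj {Y : Matrix (Fin n) (Fin n) ℂ} (hYS : Y * S = -(S * diagonal mu))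
    (x : ℂ) : (x • 1 + Y) * S = S * diagonal (fun m => x - mu m) := by
  rw [add_mul, hYS, ← diagonal_sub, Matrix.mul_sub, ← smul_one_eq_diagonal]
  simp [sub_eq_add_neg]

theorem det_smul_one_add_of_conj {Y : Matrix (Fin n) (Fin n) ℂ} (hTS : T * S = 1)
    (hYS : Y * S = -(S * Matrix.diagonal mu)) (x : ℂ) :
    (x • 1 + Y).det = ∏ m, (x - mu m) := by
  have h := congrArg Matrix.det (smul_one_add_mul_of_conj hYS x)
  have hS : S.det ≠ 0 := by
    have := congrArg Matrix.det hTS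
    rw [Matrix.det_mul, Matrix.det_one] at this
    exact right_ne_zero_of_mul (this.symm ▸ one_ne_zero)
  rw [Matrix.det_mul, Matrix.det_mul, Matrix.det_diagonal, mul_comm] at h
  exact mul_left_cancel₀ hS h

/-- The bordered determinant to which the bordered Wronskian determinant reduces. -/
noncomputable def borderedDet (t : ℕ) (a : ℕ → ℂ) (lam gam : Fin n → ℂ) (u : Entire) (x : ℂ) : ℂ :=
  (Matrix.fromBlocks (x • 1 + yMat t a lam gam)
    (Matrix.of fun k (_ : Fin 1) => gVec t a (xMat lam gam) (basisJet t a lam u x) k)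
    (Matrix.of fun (_ : Fin 1) i => cVec lam i)
    (Matrix.of fun _ _ => nodalVal t a lam u x)).det

theorem borderedDet_eq (hTS : T * S = 1)
    (hYS : yMat t a lam gam * S = -(S * Matrix.diagonal mu)) (u : Entire) (x : ℂ) :
    borderedDet t a lam gam u x =
      (Lagrange.nodal Finset.univ mu).eval x * nodalVal t a lam u x -
        ∑ m, (Lagrange.nodal (Finset.univ.erase m) mu).eval x *
          (Matrix.vecMul (cVec lam) S m *
            T.mulVec (gVec t a (xMat lam gam) (basisJet t a lam u x)) m) := by
  rw [borderedDet, det_bordered_of_conj hTS (smul_one_add_mul_of_conj hYS x)]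
  simp only [Lagrange.eval_nodal]

theorem borderedDet_apply_node (hTS : T * S = 1)
    (hYS : yMat t a lam gam * S = -(S * Matrix.diagonal mu)) (u : Entire) (k : Fin n) :
    borderedDet t a lam gam u (mu k) =
      -((Lagrange.nodal (Finset.univ.erase k) mu).eval (mu k) *
          (Matrix.vecMul (cVec lam) S k *
            T.mulVec (gVec t a (xMat lam gam) (basisJet t a lam u (mu k))) k)) := by
  rw [borderedDet_eq hTS hYS, Lagrange.eval_nodal_at_node (Finset.mem_univ k), zero_mul, zero_sub,
    Finset.sum_eq_single k]
  · intro m _ hm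
    rw [Lagrange.eval_nodal_at_node (Finset.mem_erase.2 ⟨hm.symm, Finset.mem_univ k⟩), zero_mul]
  · simp

theorem hasDerivAt_mulVec_gVec (A T : Matrix (Fin n) (Fin n) ℂ) (lam : Fin n → ℂ) (u : Entire)
    (x : ℂ) (k : Fin n) : HasDerivAt (fun x => T.mulVec (gVec t a A (basisJet t a lam u x)) k)
      (T.mulVec (gVec t a A (fun j => basisJet t a lam u x (j + 1))) k) x :=
  HasDerivAt.fun_sum (u := Finset.univ) fun p _ => (hasDerivAt_gVec A lam u x p).const_mul (T k p)

theorem conj_mulVec_gVec_add (hTS : T * S = 1)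
    (hYS : yMat t a lam gam * S = -(S * Matrix.diagonal mu)) (hX : xMat lam gam * S = S * X')
    (u : Entire) (k : Fin n) :
    ∑ m, X' k m * T.mulVec (gVec t a (xMat lam gam) (basisJet t a lam u (mu k))) m +
      T.mulVec (gVec t a (xMat lam gam) (fun j => basisJet t a lam u (mu k) (j + 1))) k =
    nodalVal t a lam u (mu k) * T.mulVec (bVec lam) k := by
  have hST : S * T = 1 := mul_eq_one_comm.1 hTS
  have hTX : T * xMat lam gam = X' * T := by
    calc T * xMat lam gam = T * (xMat lam gam * S) * T := by
          rw [Matrix.mul_assoc T, Matrix.mul_assoc (xMat lam gam), hST, Matrix.mul_one]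
      _ = X' * T := by rw [hX, ← Matrix.mul_assoc T, hTS, Matrix.one_mul]
  have hTY : T * (mu k • 1 + yMat t a lam gam) = Matrix.diagonal (fun m => mu k - mu m) * T := by
    calc T * (mu k • 1 + yMat t a lam gam) = T * ((mu k • 1 + yMat t a lam gam) * S) * T := by
          rw [Matrix.mul_assoc T, Matrix.mul_assoc _ S, hST, Matrix.mul_one]
      _ = _ := by
          rw [smul_one_add_mul_of_conj hYS, ← Matrix.mul_assoc T, hTS, Matrix.one_mul]
  have h := congrFun (congrArg T.mulVec
    (mulVec_gVec_add (t := t) (a := a) lam gam u (mu k))) k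
  have e : mu k • basisJet t a lam u (mu k) 0 +
      (yMat t a lam gam).mulVec (basisJet t a lam u (mu k) 0) =
      (mu k • 1 + yMat t a lam gam).mulVec (basisJet t a lam u (mu k) 0) := by
    rw [Matrix.add_mulVec, Matrix.smul_mulVec, Matrix.one_mulVec]
  rw [e, Matrix.mulVec_add, Matrix.mulVec_add, Matrix.mulVec_mulVec, Matrix.mulVec_mulVec, hTX, hTY,
    ← Matrix.mulVec_mulVec, ← Matrix.mulVec_mulVec, Pi.add_apply, Pi.add_apply,
    Matrix.mulVec_diagonal, sub_self, zero_mul, zero_add, Matrix.mulVec_smul, Pi.smul_apply,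
    smul_eq_mul] at h
  exact h

theorem eval_derivative_nodal_erase_of_ne (mu : Fin n → ℂ) {k m : Fin n} (h : m ≠ k) :
    (mu k - mu m) * (derivative (Lagrange.nodal (Finset.univ.erase m) mu)).eval (mu k) =
      (Lagrange.nodal (Finset.univ.erase k) mu).eval (mu k) := by
  rw [Lagrange.eval_nodal_derivative_eval_node_eq
      (Finset.mem_erase.2 ⟨h.symm, Finset.mem_univ k⟩),
    Lagrange.nodal_eq_mul_nodal_erase (s := Finset.univ.erase k) (i := m)
      (Finset.mem_erase.2 ⟨h, Finset.mem_univ m⟩), Finset.erase_right_comm]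
  simp

theorem eval_derivative_nodal_erase (hmu : Function.Injective mu) (k : Fin n) :
    (derivative (Lagrange.nodal (Finset.univ.erase k) mu)).eval (mu k) =
      (Lagrange.nodal (Finset.univ.erase k) mu).eval (mu k) *
        ∑ m ∈ Finset.univ.erase k, (mu k - mu m)⁻¹ := by
  rw [Lagrange.derivative_nodal, eval_finsetSum, Finset.mul_sum]
  refine Finset.sum_congr rfl fun m hm => ?_
  have hne : mu k - mu m ≠ 0 := sub_ne_zero.2 (hmu.ne (Finset.mem_erase.1 hm).1.symm)
  rw [Lagrange.nodal_eq_mul_nodal_erase hm]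
  simp only [eval_mul, eval_sub, eval_X, eval_C]
  field_simp

theorem deriv_borderedDet (hlam : Function.Injective lam) (hmu : Function.Injective mu)
    (hTS : T * S = 1) (hYS : yMat t a lam gam * S = -(S * Matrix.diagonal mu))
    (hX : xMat lam gam * S = S * X') (u : Entire) (k : Fin n) :
    deriv (borderedDet t a lam gam u) (mu k) +
      (X' k k - ∑ m ∈ Finset.univ.erase k, (mu k - mu m)⁻¹) *
        borderedDet t a lam gam u (mu k) = 0 := by
  set b' := T.mulVec (bVec lam) with hb'
  set c' := Matrix.vecMul (cVec lam) S with hc'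
  set g := T.mulVec (gVec t a (xMat lam gam) (basisJet t a lam u (mu k))) with hg
  set g' := T.mulVec (gVec t a (xMat lam gam) (fun j => basisJet t a lam u (mu k) (j + 1))) with hg'
  set τ := (Lagrange.nodal (Finset.univ.erase k) mu).eval (mu k) with hτ
  set s := ∑ m ∈ Finset.univ.erase k, (mu k - mu m)⁻¹ with hs
  have hd : HasDerivAt (borderedDet t a lam gam u)
      ((derivative (Lagrange.nodal Finset.univ mu)).eval (mu k) * nodalVal t a lam u (mu k) +
        (Lagrange.nodal Finset.univ mu).eval (mu k) * deriv (nodalVal t a lam u) (mu k) -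
        ∑ m, ((derivative (Lagrange.nodal (Finset.univ.erase m) mu)).eval (mu k) * (c' m * g m) +
          (Lagrange.nodal (Finset.univ.erase m) mu).eval (mu k) * (c' m * g' m))) (mu k) := by
    rw [funext (borderedDet_eq hTS hYS u)]
    have hν : HasDerivAt (nodalVal t a lam u) (deriv (nodalVal t a lam u) (mu k)) (mu k) :=
      ((aeval (airyEnd (t + 2) a) (Lagrange.nodal Finset.univ lam) u).2 (mu k)).hasDerivAt
    exact ((Polynomial.hasDerivAt _ _).mul hν).sub
      (HasDerivAt.fun_sum fun m _ => (Polynomial.hasDerivAt _ _).mul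
        ((hasDerivAt_mulVec_gVec _ T lam u (mu k) m).const_mul _))
  have hbc : ∀ i, b' k * c' i = (if k = i then 1 else 0) + (mu k - mu i) * X' k i := fun i => by
    rw [sub_mul_conj hlam hTS hYS hX]
    ring
  have hbck : c' k * b' k = 1 := by
    have := hbc k
    simp only [if_true, sub_self, zero_mul, add_zero] at this
    rw [mul_comm, this]
  have hne : ∀ m ∈ Finset.univ.erase k,
      (derivative (Lagrange.nodal (Finset.univ.erase m) mu)).eval (mu k) * (c' m * g m) +
          (Lagrange.nodal (Finset.univ.erase m) mu).eval (mu k) * (c' m * g' m) =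
        τ * (c' k * (X' k m * g m)) := by
    intro m hm
    have hmk := (Finset.mem_erase.1 hm).1
    have h0 : mu k - mu m ≠ 0 := sub_ne_zero.2 (hmu.ne hmk.symm)
    have h1 := eval_derivative_nodal_erase_of_ne mu hmk
    have h2 := hbc m
    rw [if_neg hmk.symm, zero_add] at h2
    rw [Lagrange.eval_nodal_at_node (Finset.mem_erase.2 ⟨hmk.symm, Finset.mem_univ k⟩), zero_mul,
      add_zero]
    refine mul_left_cancel₀ h0 ?_
    rw [← hτ] at h1
    linear_combination (c' m * g m) * h1 + τ * c' k * g m * h2 - τ * c' m * g m * hbck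
  have hmain := conj_mulVec_gVec_add hTS hYS hX u k
  rw [← Finset.add_sum_erase _ _ (Finset.mem_univ k)] at hmain
  rw [hd.deriv, borderedDet_apply_node hTS hYS, Lagrange.eval_nodal_at_node (Finset.mem_univ k),
    Lagrange.eval_nodal_derivative_eval_node_eq (Finset.mem_univ k),
    ← Finset.add_sum_erase _ _ (Finset.mem_univ k), Finset.sum_congr rfl hne,
    eval_derivative_nodal_erase hmu, ← Finset.mul_sum, ← Finset.mul_sum]
  simp only [← hτ, ← hs, ← hg, ← hc', ← hb', ← hg'] at hmain ⊢
  linear_combination -(τ * c' k) * hmain - τ * nodalVal t a lam u (mu k) * hbck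

end Spectral

section TestFunction

variable {n t : ℕ} {a : ℕ → ℂ}

/-- A normalized power of `x - z`. -/
noncomputable def testFun (z : ℂ) (N : ℕ) : Entire :=
  ⟨fun x => (N.factorial : ℂ)⁻¹ * (x - z) ^ N,
    show Differentiable ℂ fun x => (N.factorial : ℂ)⁻¹ * (x - z) ^ N by fun_prop⟩

theorem iteratedDeriv_testFun (z : ℂ) (N m : ℕ) :
    iteratedDeriv m (testFun z N).1 z = if m = N then 1 else 0 := by
  have h : (testFun z N).1 = fun x => (N.factorial : ℂ)⁻¹ * (fun y => y ^ N) (x - z) := rfl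
  rw [h, iteratedDeriv_const_mul_field, iteratedDeriv_comp_sub_const (f := fun y : ℂ => y ^ N)]
  simp only [sub_self, iteratedDeriv_fun_pow_zero]
  split_ifs
  · exact inv_mul_cancel₀ (Nat.cast_ne_zero.2 N.factorial_ne_zero)
  · rw [Nat.cast_zero, mul_zero]

theorem IsMonicOp.apply_testFun {k N : ℕ} {P : Module.End ℂ Entire} (hP : IsMonicOp k P)
    (hk : k ≤ N) (z : ℂ) : (P (testFun z N)).1 z = if k = N then 1 else 0 := by
  obtain ⟨c, hc⟩ := hP.exists_coeff z
  rw [hc, iteratedDeriv_testFun, Finset.sum_eq_zero, add_zero]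
  intro m hm
  rw [iteratedDeriv_testFun, if_neg ((Finset.mem_range.1 hm).trans_le hk).ne, mul_zero]

theorem basis_eq_C_mul_nodal_erase (lam : Fin n → ℂ) (i : Fin n) :
    Lagrange.basis Finset.univ lam i =
      C (bVec lam i) * Lagrange.nodal (Finset.univ.erase i) lam := by
  have h := X_sub_C_mul_basis lam i
  rw [Lagrange.nodal_eq_mul_nodal_erase (Finset.mem_univ i), mul_left_comm] at h
  exact mul_left_cancel₀ (X_sub_C_ne_zero _) h

theorem basisJet_testFun (lam : Fin n → ℂ) (z : ℂ) {j : ℕ} (hj : j ≤ t + 1) (i : Fin n) :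
    basisJet t a lam (testFun z ((t + 2) * n - 1)) z j i =
      if j = t + 1 then bVec lam i else 0 := by
  have hP := (isMonicOp_aeval (r := t + 2) (by omega) a
    (Lagrange.nodal_monic (s := Finset.univ.erase i) (v := lam))).dOp_pow_mul j
  rw [Lagrange.natDegree_nodal, Finset.card_erase_of_mem (Finset.mem_univ i), Finset.card_fin] at hP
  obtain ⟨n', rfl⟩ : ∃ n', n = n' + 1 := ⟨n - 1, by have := i.pos; omega⟩
  have hN : (t + 2) * (n' + 1) - 1 = (t + 2) * n' + (t + 1) := by rw [mul_add]; omega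
  have h := hP.apply_testFun (N := (t + 2) * n' + (t + 1))
    (by rw [Nat.add_sub_cancel]; omega) z
  rw [Nat.add_sub_cancel, Module.End.mul_apply] at h
  rw [hN, basisJet, basis_eq_C_mul_nodal_erase, map_mul, aeval_C, Module.End.mul_apply,
    Module.algebraMap_end_apply, map_smul, smul_apply, h]
  simp

theorem gVec_basisJet_testFun (A : Matrix (Fin n) (Fin n) ℂ) (lam : Fin n → ℂ) (z : ℂ) :
    gVec t a A (basisJet t a lam (testFun z ((t + 2) * n - 1)) z) = bVec lam := by
  funext k
  rw [gVec_apply, basisJet_testFun lam z le_rfl, if_pos rfl, Finset.sum_eq_zero, sub_zero]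
  intro p _
  have hp := p.1.isLt
  rw [basisJet_testFun lam z hp.le, if_neg hp.ne, mul_zero]

end TestFunction

section Duality

variable {n t : ℕ} {a : ℕ → ℂ} {lam gam mu gam' : Fin n → ℂ} {S T : Matrix (Fin n) (Fin n) ℂ}

theorem borderedDet_testFun_ne_zero (hlam : Function.Injective lam) (hmu : Function.Injective mu)
    (hTS : T * S = 1) (hYS : yMat t a lam gam * S = -(S * Matrix.diagonal mu)) (k : Fin n) :
    borderedDet t a lam gam (testFun (mu k) ((t + 2) * n - 1)) (mu k) ≠ 0 := by
  have hX : xMat lam gam * S = S * (T * xMat lam gam * S) := by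
    rw [← Matrix.mul_assoc, ← Matrix.mul_assoc, mul_eq_one_comm.1 hTS, Matrix.one_mul]
  have h := sub_mul_conj hlam hTS hYS hX k k
  rw [sub_self, zero_mul, if_pos rfl] at h
  rw [borderedDet_apply_node hTS hYS, gVec_basisJet_testFun, mul_comm (Matrix.vecMul _ _ _),
    sub_eq_zero.1 h.symm, mul_one, neg_ne_zero]
  exact Lagrange.eval_nodal_not_at_node fun m hm => hmu.ne (Finset.mem_erase.1 hm).1.symm

theorem exists_conj_diagonal {Y : Matrix (Fin n) (Fin n) ℂ} (hmu : Function.Injective mu)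
    (hdet : ∀ k, (mu k • 1 + Y).det = 0) : ∃ S T : Matrix (Fin n) (Fin n) ℂ,
      T * S = 1 ∧ Y * S = -(S * Matrix.diagonal mu) := by
  choose v hv0 hv using fun k => Matrix.exists_mulVec_eq_zero_iff.2 (hdet k)
  have hYv : ∀ k, Y.mulVec (v k) = -mu k • v k := fun k => by
    have h := hv k
    rw [Matrix.add_mulVec, Matrix.smul_mulVec, Matrix.one_mulVec] at h
    rw [neg_smul]
    exact eq_neg_of_add_eq_zero_right h
  have hli : LinearIndependent ℂ v :=
    Module.End.eigenvectors_linearIndependent' (Matrix.toLin' Y) (fun k => -mu k)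
      (neg_injective.comp hmu) v fun k =>
        ⟨Module.End.mem_eigenspace_iff.2 (by rw [Matrix.toLin'_apply, hYv]), hv0 k⟩
  let S : Matrix (Fin n) (Fin n) ℂ := Matrix.of fun i k => v k i
  have hS : IsUnit S := Matrix.linearIndependent_cols_iff_isUnit.1 hli
  refine ⟨S, S⁻¹, Matrix.nonsing_inv_mul S ((Matrix.isUnit_iff_isUnit_det S).1 hS), ?_⟩
  ext i k
  rw [Matrix.neg_apply, Matrix.mul_diagonal]
  have h := congrFun (hYv k) i
  rw [Pi.smul_apply, smul_eq_mul] at h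
  exact h.trans (by simp [S, mul_comm])

theorem aeval_mul_of_mul_eq_mul_transpose {A B R : Matrix (Fin n) (Fin n) ℂ}
    (h : A * R = R * B.transpose) (p : ℂ[X]) :
    aeval A p * R = R * (aeval B p).transpose := by
  induction p using Polynomial.induction_on' with
  | add p q hp hq => rw [map_add, map_add, add_mul, hp, hq, Matrix.transpose_add, mul_add]
  | monomial m c =>
    have hm : A ^ m * R = R * (B ^ m).transpose := by
      induction m with
      | zero => simp
      | succ m ih =>
        rw [pow_succ', Matrix.mul_assoc, ih, ← Matrix.mul_assoc, h, Matrix.mul_assoc,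
          ← Matrix.transpose_mul, ← pow_succ]
    rw [aeval_monomial, aeval_monomial, ← Algebra.smul_def, ← Algebra.smul_def, smul_mul_assoc, hm,
      Matrix.transpose_smul, mul_smul_comm]

theorem exists_dual_conj (hlam : Function.Injective lam) (hmu : Function.Injective mu)
    (hTS : T * S = 1) (hYS : yMat t a lam gam * S = -(S * Matrix.diagonal mu))
    (hgam' : ∀ k, gam' k =
      (T * xMat lam gam * S) k k - ∑ m ∈ Finset.univ.erase k, (mu k - mu m)⁻¹) :
    ∃ R Q : Matrix (Fin n) (Fin n) ℂ, Q * R = 1 ∧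
      yMat t a mu gam' * R = -(R * Matrix.diagonal lam) ∧
      xMat mu gam' * R = R * (xMat lam gam).transpose := by
  have hST : S * T = 1 := mul_eq_one_comm.1 hTS
  set X' := T * xMat lam gam * S with hX'
  have hX : xMat lam gam * S = S * X' := by
    rw [hX', ← Matrix.mul_assoc, ← Matrix.mul_assoc, hST, Matrix.one_mul]
  set b' := T.mulVec (bVec lam) with hb'
  set c' := Matrix.vecMul (cVec lam) S with hc'
  have hsub : ∀ k i, (mu k - mu i) * X' k i = b' k * c' i - if k = i then 1 else 0 :=
    sub_mul_conj hlam hTS hYS hX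
  have hbc : ∀ k, b' k * c' k = 1 := fun k => by
    have := hsub k k
    rw [sub_self, zero_mul, if_pos rfl] at this
    exact sub_eq_zero.1 this.symm
  let d : Fin n → ℂ := fun k => bVec mu k * b' k
  have hd : ∀ k, d k ≠ 0 := fun k => mul_ne_zero
    (left_ne_zero_of_mul (bVec_mul_cVec hmu k ▸ one_ne_zero))
    (left_ne_zero_of_mul (hbc k ▸ one_ne_zero))
  have hXd : xMat mu gam' * Matrix.diagonal d = Matrix.diagonal d * X'.transpose := by
    ext k i
    rw [Matrix.mul_diagonal, Matrix.diagonal_mul, Matrix.transpose_apply]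
    by_cases hki : k = i
    · subst hki
      rw [xMat_diag hmu, hgam' k]
      ring
    · refine mul_left_cancel₀ (sub_ne_zero.2 (hmu.ne hki)) ?_
      have h1 := sub_mul_xMat hmu gam' k i
      have h2 := hsub i k
      rw [if_neg hki] at h1
      rw [if_neg (Ne.symm hki)] at h2
      linear_combination d i * h1 + d k * h2 - bVec mu k * b' i * (bVec_mul_cVec hmu i) +
        bVec mu k * b' i * hbc k
  have hXR : xMat mu gam' * (Matrix.diagonal d * S.transpose) =
      Matrix.diagonal d * S.transpose * (xMat lam gam).transpose := by
    rw [← Matrix.mul_assoc, hXd, Matrix.mul_assoc, ← Matrix.transpose_mul, ← hX,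
      Matrix.transpose_mul, ← Matrix.mul_assoc]
  refine ⟨Matrix.diagonal d * S.transpose, T.transpose * Matrix.diagonal d⁻¹, ?_, ?_, hXR⟩
  · rw [Matrix.mul_assoc, ← Matrix.mul_assoc (Matrix.diagonal d⁻¹), Matrix.diagonal_mul_diagonal]
    have : (fun i => d⁻¹ i * d i) = 1 := funext fun i => inv_mul_cancel₀ (hd i)
    rw [this, Matrix.diagonal_one', Matrix.one_mul, ← Matrix.transpose_mul, hST,
      Matrix.transpose_one]
  · have h := congrArg Matrix.transpose hYS
    rw [Matrix.transpose_mul, Matrix.transpose_neg, Matrix.transpose_mul,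
      Matrix.diagonal_transpose] at h
    have hcomm : Matrix.diagonal mu * (Matrix.diagonal d * S.transpose) =
        -(Matrix.diagonal d * S.transpose * (yMat t a lam gam).transpose) := by
      rw [Matrix.mul_assoc, h, Matrix.mul_neg, neg_neg, ← Matrix.mul_assoc, ← Matrix.mul_assoc,
        Matrix.diagonal_mul_diagonal, Matrix.diagonal_mul_diagonal]
      simp only [mul_comm]
    rw [yMat, add_mul, hcomm, aeval_mul_of_mul_eq_mul_transpose hXR, yMat, Matrix.transpose_add,
      Matrix.diagonal_transpose, Matrix.mul_add]
    abel

end Duality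

section Involution

variable {n t : ℕ} {a : ℕ → ℂ} {F : Fin (t + 2) → Entire} {lam gam mu gam' : Fin n → ℂ}

theorem bispectral_involution (hF : ∀ j, airyEnd (t + 2) a (F j) = 0)
    (hwr : ∀ x, wrDet (t + 2) (fun j => (F j).1) x = 1)
    (hlam : Function.Injective lam) (hmu : Function.Injective mu)
    (hroots : ∀ k, wrDet ((t + 2) * n) (fun s => (phi F lam gam (colEquiv n t s)).1) (mu k) = 0)
    (hgam' : ∀ k (u : Entire),
      deriv (wrDetB ((t + 2) * n) (fun s => (phi F lam gam (colEquiv n t s)).1) u.1) (mu k) +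
        gam' k *
          wrDetB ((t + 2) * n) (fun s => (phi F lam gam (colEquiv n t s)).1) u.1 (mu k) = 0) :
    (∀ x, wrDet ((t + 2) * n) (fun s => (phi F mu gam' (colEquiv n t s)).1) x = 0 ↔
      ∃ i, x = lam i) ∧
    ∀ i (u : Entire),
      deriv (wrDetB ((t + 2) * n) (fun s => (phi F mu gam' (colEquiv n t s)).1) u.1) (lam i) +
        gam i *
          wrDetB ((t + 2) * n) (fun s => (phi F mu gam' (colEquiv n t s)).1) u.1 (lam i) = 0 := by
  obtain ⟨κ, hκ, hdet, hbord⟩ := exists_wronskian_formula hF hwr hlam gam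
  obtain ⟨S, T, hTS, hYS⟩ := exists_conj_diagonal (Y := yMat t a lam gam) hmu fun k =>
    (mul_eq_zero.1 ((hdet (mu k)).symm.trans (hroots k))).resolve_left hκ
  have hX : xMat lam gam * S = S * (T * xMat lam gam * S) := by
    rw [← Matrix.mul_assoc, ← Matrix.mul_assoc, mul_eq_one_comm.1 hTS, Matrix.one_mul]
  have hgam'_eq : ∀ k, gam' k =
      (T * xMat lam gam * S) k k - ∑ m ∈ Finset.univ.erase k, (mu k - mu m)⁻¹ := fun k => by
    have h1 := hgam' k (testFun (mu k) ((t + 2) * n - 1))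
    have h2 := deriv_borderedDet hlam hmu hTS hYS hX (testFun (mu k) ((t + 2) * n - 1)) k
    rw [funext (hbord _)] at h1
    change deriv (fun x => κ * borderedDet t a lam gam _ x) (mu k) +
      gam' k * (κ * borderedDet t a lam gam _ (mu k)) = 0 at h1
    rw [deriv_const_mul_field] at h1
    have h3 := borderedDet_testFun_ne_zero hlam hmu hTS hYS k
    refine mul_right_cancel₀ (mul_ne_zero hκ h3) ?_
    linear_combination h1 - κ * h2
  obtain ⟨R, Q, hQR, hYR, hXR⟩ := exists_dual_conj hlam hmu hTS hYS hgam'_eq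
  obtain ⟨κ', hκ', hdet', hbord'⟩ := exists_wronskian_formula hF hwr hmu gam'
  refine ⟨fun x => ?_, fun i u => ?_⟩
  · rw [hdet', det_smul_one_add_of_conj hQR hYR, mul_eq_zero, or_iff_right hκ',
      Finset.prod_eq_zero_iff]
    simp [sub_eq_zero]
  · have h := deriv_borderedDet hmu hlam hQR hYR hXR u i
    rw [Matrix.transpose_apply, xMat_diag hlam, add_sub_cancel_right] at h
    rw [funext (hbord' u)]
    change deriv (fun x => κ' * borderedDet t a mu gam' u x) (lam i) +
      gam i * (κ' * borderedDet t a mu gam' u (lam i)) = 0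
    rw [deriv_const_mul_field]
    linear_combination κ' * h

theorem phiFam_eq (f : ℕ → ℂ → ℂ) (hf : ∀ j : Fin (t + 2), Differentiable ℂ (f j)) (n : ℕ)
    (lam gam : ℕ → ℂ) : phiFam (t + 2) n f lam gam = fun s =>
      (phi (fun j => (⟨f j, hf j⟩ : Entire)) (fun i : Fin n => lam i) (fun i : Fin n => gam i)
        (colEquiv n t s)).1 := by
  funext s x
  simp only [phi]
  rw [add_apply, smul_apply, dOp_apply, colEquiv_snd]
  simp only [shift, colEquiv_fst]
  rw [deriv_comp_add_const]
  rfl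

end Involution

end AiryBispectral

open AiryBispectral in
theorem statement5 (r n : ℕ) (a : ℕ → ℂ) (f : ℕ → ℂ → ℂ) (lam gam : ℕ → ℂ)
    (hr : 2 ≤ r) (hn : 1 ≤ n)
    (hf : ∀ j < r, Differentiable ℂ (f j))
    (hker : ∀ j < r, ∀ x : ℂ, airyOp r a (f j) x = 0)
    (hwrf : ∀ x : ℂ, wrDet r (fun j => f j.val) x = 1)
    (hlam : ∀ i < n, ∀ j < n, i ≠ j → lam i ≠ lam j)
    (mu gam' : ℕ → ℂ)
    (hmu : ∀ k < n, ∀ l < n, k ≠ l → mu k ≠ mu l)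
    (hroots : ∀ x : ℂ, wrDet (r * n) (phiFam r n f lam gam) x = 0 ↔ ∃ k < n, x = mu k)
    (hgam' : ∀ k < n, ∀ u : ℂ → ℂ, Differentiable ℂ u →
      deriv (wrDetB (r * n) (phiFam r n f lam gam) u) (mu k)
        + gam' k * wrDetB (r * n) (phiFam r n f lam gam) u (mu k) = 0) :
    (∀ x : ℂ, wrDet (r * n) (phiFam r n f mu gam') x = 0 ↔ ∃ i < n, x = lam i) ∧
    ∀ i < n, ∀ u : ℂ → ℂ, Differentiable ℂ u →
      deriv (wrDetB (r * n) (phiFam r n f mu gam') u) (lam i)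
        + gam i * wrDetB (r * n) (phiFam r n f mu gam') u (lam i) = 0 := by
  obtain ⟨t, rfl⟩ : ∃ t, r = t + 2 := ⟨r - 2, by omega⟩
  have hf' : ∀ j : Fin (t + 2), Differentiable ℂ (f j) := fun j => hf j j.isLt
  have hF : ∀ j : Fin (t + 2), airyEnd (t + 2) a (⟨f j, hf' j⟩ : Entire) = 0 := fun j =>
    Entire.ext fun x => (airyEnd_apply _ _ _ x).trans (hker j j.isLt x)
  have hinj : ∀ z : ℕ → ℂ, (∀ i < n, ∀ j < n, i ≠ j → z i ≠ z j) →
      Function.Injective fun i : Fin n => z i := fun z hz i j hij => by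
    by_contra hne
    exact hz i i.isLt j j.isLt (Fin.val_ne_of_ne hne) hij
  rw [phiFam_eq f hf'] at hroots hgam' ⊢
  obtain ⟨h1, h2⟩ := bispectral_involution hF hwrf (hinj lam hlam) (hinj mu hmu)
    (fun k => (hroots _).2 ⟨k, k.isLt, rfl⟩) (fun k u => hgam' k k.isLt u.1 u.2)
  refine ⟨fun x => (h1 x).trans ?_, fun i hi u hu => h2 ⟨i, hi⟩ ⟨u, hu⟩⟩
  exact ⟨fun ⟨i, hi⟩ => ⟨i, i.isLt, hi⟩, fun ⟨i, hi, h⟩ => ⟨⟨i, hi⟩, h⟩⟩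
end

section
/- Let f be any element of the ℂ-span of f_1, …, f_r, let q(z) := ∏_{i=1}^n (z − λ_i) and τ(x) := ∏_{k=1}^n (x − μ_k). Then for all x, z ∈ ℂ with det Wr(φ_1, …, φ_N)(x) ≠ 0, det Wr(φ^β_1, …, φ^β_N)(z) ≠ 0, q(z) ≠ 0 and τ(x) ≠ 0, one has det Wr(φ_1, …, φ_N, f(·+z))(x) / (det Wr(φ_1, …, φ_N)(x)·q(z)) = det Wr(φ^β_1, …, φ^β_N, f(·+x))(z) / (det Wr(φ^β_1, …, φ^β_N)(z)·τ(x)), where f(·+z) denotes the function x ↦ f(x+z). That is, the eigenfunctions satisfy 𝐟_C(x,z) = 𝐟_{C^β}(z,x): the bispectral involution exchanges the spatial and spectral parameters. -/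
open scoped BigOperators

section Bispectral

open Polynomial Matrix

/-- Entire solutions of `L₀ g = 0`. -/
structure IsAiry (r : ℕ) (a : ℕ → ℂ) (g : ℂ → ℂ) : Prop where
  diff : Differentiable ℂ g
  eqn : ∀ x, airyOp r a g x = 0

theorem Differentiable.contDiff_complex {g : ℂ → ℂ} (hg : Differentiable ℂ g) (k : ℕ) :
    ContDiff ℂ k g := hg.contDiff

theorem Differentiable.iteratedDeriv_complex {g : ℂ → ℂ} (hg : Differentiable ℂ g) (k : ℕ) :
    Differentiable ℂ (iteratedDeriv k g) :=
  (hg.contDiff_complex (k + 1)).differentiable_iteratedDeriv k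
    (by exact_mod_cast Nat.lt_succ_self k)

theorem Differentiable.hasDerivAt_iteratedDeriv {g : ℂ → ℂ} (hg : Differentiable ℂ g) (k : ℕ)
    (y : ℂ) : HasDerivAt (iteratedDeriv k g) (iteratedDeriv (k + 1) g y) y := by
  rw [iteratedDeriv_succ]
  exact (hg.iteratedDeriv_complex k y).hasDerivAt

theorem Differentiable.hasDerivAt_iteratedDeriv_shift {g : ℂ → ℂ} (hg : Differentiable ℂ g)
    (k : ℕ) (x z : ℂ) :
    HasDerivAt (fun z => iteratedDeriv k g (x + z)) (iteratedDeriv (k + 1) g (x + z)) z :=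
  (hg.hasDerivAt_iteratedDeriv k (x + z)).comp_const_add x z

namespace IsAiry

variable {r : ℕ} {a : ℕ → ℂ} {g : ℂ → ℂ}

theorem iteratedDeriv_eq (hg : IsAiry r a g) (y : ℂ) :
    iteratedDeriv r g y
      = (∑ m ∈ Finset.Ico 1 (r - 1), a m * iteratedDeriv m g y) + y * g y := by
  have := hg.eqn y
  unfold airyOp at this
  linear_combination this

theorem iteratedDeriv_add_eq (hg : IsAiry r a g) (k : ℕ) : ∀ y : ℂ,
    iteratedDeriv (k + r) g y
      = (∑ m ∈ Finset.Ico 1 (r - 1), a m * iteratedDeriv (k + m) g y)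
        + y * iteratedDeriv k g y + k * iteratedDeriv (k - 1) g y := by
  induction k with
  | zero => intro y; simpa using hg.iteratedDeriv_eq y
  | succ k ih =>
    intro y
    have h1 := hg.diff.hasDerivAt_iteratedDeriv (k + r) y
    have h2 := ((HasDerivAt.fun_sum (u := Finset.Ico 1 (r - 1)) fun m _ =>
      (hg.diff.hasDerivAt_iteratedDeriv (k + m) y).const_mul (a m)).add
      ((hasDerivAt_id y).mul (hg.diff.hasDerivAt_iteratedDeriv k y))).add
      ((hg.diff.hasDerivAt_iteratedDeriv (k - 1) y).const_mul (k : ℂ))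
    have h3 := h1.unique (h2.congr_of_eventuallyEq (Filter.Eventually.of_forall fun w => by
      simpa using ih w))
    have e1 : k + 1 + r = k + r + 1 := by ring
    rw [e1, h3]
    have e2 : ∀ m, k + 1 + m = k + m + 1 := fun m => by ring
    simp only [e2]
    rcases k with _ | k
    · simp; ring
    · simp; ring

theorem add {g' : ℂ → ℂ} (hg : IsAiry r a g) (hg' : IsAiry r a g') :
    IsAiry r a (g + g') := by
  refine ⟨hg.diff.add hg'.diff, fun x => ?_⟩
  have h := fun k : ℕ => iteratedDeriv_add (hg.diff.contDiff_complex k).contDiffAt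
    (hg'.diff.contDiff_complex k).contDiffAt (x := x)
  have h1 := hg.eqn x
  have h2 := hg'.eqn x
  unfold airyOp at *
  simp only [h, mul_add, Finset.sum_add_distrib, Pi.add_apply]
  linear_combination h1 + h2

theorem const_smul (c : ℂ) (hg : IsAiry r a g) : IsAiry r a (c • g) := by
  refine ⟨hg.diff.const_smul c, fun x => ?_⟩
  have h := fun k : ℕ => iteratedDeriv_const_mul_field (n := k) (x := x) c g
  have h1 := hg.eqn x
  have e : c • g = fun x => c * g x := rfl
  unfold airyOp at *
  rw [e]
  simp only [h, mul_left_comm _ c, ← Finset.mul_sum]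
  linear_combination c * h1

theorem zero : IsAiry r a 0 := by
  refine ⟨differentiable_const 0, fun x => ?_⟩
  have h : ∀ k : ℕ, iteratedDeriv k (0 : ℂ → ℂ) x = 0 := fun k => by simp
  simp [airyOp, h]

theorem of_mem_span {S : Set (ℂ → ℂ)} (hS : ∀ g ∈ S, IsAiry r a g)
    (hg : g ∈ Submodule.span ℂ S) : IsAiry r a g := by
  induction hg using Submodule.span_induction with
  | mem g hg => exact hS g hg
  | zero => exact zero
  | add _ _ _ _ h h' => exact h.add h'
  | smul c _ _ h => exact h.const_smul c

end IsAiry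

/-- The value at `y` of the constant coefficient differential operator `K(∂)` applied to `g`. -/
noncomputable def evalOp (g : ℂ → ℂ) (y : ℂ) : ℂ[X] →ₗ[ℂ] ℂ :=
  Polynomial.lsum fun k => iteratedDeriv k g y • LinearMap.id

theorem evalOp_monomial (g : ℂ → ℂ) (y : ℂ) (k : ℕ) (c : ℂ) :
    evalOp g y (monomial k c) = c * iteratedDeriv k g y := by
  simp [evalOp, Polynomial.lsum_apply, mul_comm]

theorem evalOp_C_mul_X_pow (g : ℂ → ℂ) (y : ℂ) (k : ℕ) (c : ℂ) :
    evalOp g y (C c * X ^ k) = c * iteratedDeriv k g y := by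
  rw [C_mul_X_pow_eq_monomial, evalOp_monomial]

theorem evalOp_X_pow (g : ℂ → ℂ) (y : ℂ) (k : ℕ) :
    evalOp g y (X ^ k) = iteratedDeriv k g y := by
  simpa using evalOp_C_mul_X_pow g y k 1

theorem evalOp_eq_sum (g : ℂ → ℂ) (y : ℂ) {K : ℂ[X]} {M : ℕ} (hK : K.natDegree < M) :
    evalOp g y K = ∑ k ∈ Finset.range M, K.coeff k * iteratedDeriv k g y := by
  conv_lhs => rw [K.as_sum_range' M hK]
  simp [evalOp_monomial]

theorem evalOp_shift (g : ℂ → ℂ) (y z : ℂ) :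
    evalOp (fun t => g (t + z)) y = evalOp g (y + z) := by
  simp only [evalOp, iteratedDeriv_comp_add_const]

theorem hasDerivAt_evalOp {g : ℂ → ℂ} (hg : Differentiable ℂ g) (x z : ℂ) (K : ℂ[X]) :
    HasDerivAt (fun z => evalOp g (x + z) K) (evalOp (deriv g) (x + z) K) z := by
  simp only [evalOp_eq_sum _ _ (Nat.lt_succ_self K.natDegree), ← iteratedDeriv_succ']
  exact HasDerivAt.fun_sum fun k _ => (hg.hasDerivAt_iteratedDeriv_shift k x z).const_mul _

/-- The symbol `∂^r - ∑ a_k ∂^k` of the differential part of `L₀`. -/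
noncomputable def airySymbol (r : ℕ) (a : ℕ → ℂ) : ℂ[X] :=
  X ^ r - ∑ m ∈ Finset.Ico 1 (r - 1), C (a m) * X ^ m

/-- The operator on symbols which corresponds to multiplication by `z` on the functions
`z ↦ (K(∂) g)(x + z)` with `L₀ g = 0`. -/
noncomputable def mulZ (r : ℕ) (a : ℕ → ℂ) (x : ℂ) : Module.End ℂ ℂ[X] :=
  LinearMap.mulLeft ℂ (airySymbol r a) - x • LinearMap.id - Polynomial.derivative

theorem evalOp_mulZ {r : ℕ} {a : ℕ → ℂ} {g : ℂ → ℂ} (hg : IsAiry r a g) (x z : ℂ) (K : ℂ[X]) :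
    evalOp g (x + z) (mulZ r a x K) = z * evalOp g (x + z) K := by
  induction K using Polynomial.induction_on' with
  | add p q hp hq => rw [map_add, map_add, hp, hq, map_add, mul_add]
  | monomial k c =>
    have e : mulZ r a x (monomial k c) = monomial (k + r) c
        - ∑ m ∈ Finset.Ico 1 (r - 1), monomial (k + m) (c * a m) - monomial k (x * c)
        - monomial (k - 1) (c * k) := by
      have h1 : mulZ r a x (monomial k c)
          = airySymbol r a * monomial k c - x • monomial k c - derivative (monomial k c) := rfl
      have h2 : airySymbol r a = monomial r 1 - ∑ m ∈ Finset.Ico 1 (r - 1), monomial m (a m) := by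
        simp only [airySymbol, C_mul_X_pow_eq_monomial, monomial_one_right_eq_X_pow]
      rw [h1, h2, derivative_monomial, smul_monomial, smul_eq_mul, sub_mul, Finset.sum_mul,
        monomial_mul_monomial, one_mul, add_comm r k]
      simp only [monomial_mul_monomial, add_comm _ k, mul_comm _ c]
    rw [e]
    simp only [map_sub, map_sum, evalOp_monomial, hg.iteratedDeriv_add_eq k]
    have : ∑ m ∈ Finset.Ico 1 (r - 1), c * a m * iteratedDeriv (k + m) g (x + z)
        = c * ∑ m ∈ Finset.Ico 1 (r - 1), a m * iteratedDeriv (k + m) g (x + z) := by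
      rw [Finset.mul_sum]
      exact Finset.sum_congr rfl fun m _ => by ring
    rw [this]
    ring

theorem evalOp_aeval_mulZ {r : ℕ} {a : ℕ → ℂ} {g : ℂ → ℂ} (hg : IsAiry r a g) (x z : ℂ)
    (q K : ℂ[X]) :
    evalOp g (x + z) (aeval (mulZ r a x) q K) = q.eval z * evalOp g (x + z) K := by
  induction q using Polynomial.induction_on with
  | C c => simp [Algebra.algebraMap_eq_smul_one]
  | add p q hp hq => simp [hp, hq, add_mul]
  | monomial k c ih =>
    have : (C c * X ^ (k + 1) : ℂ[X]) = X * (C c * X ^ k) := by ring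
    rw [this, map_mul, aeval_X, Module.End.mul_apply, evalOp_mulZ hg, ih]
    simp; ring

theorem isMonicOfDegree_airySymbol {r : ℕ} (hr : 2 ≤ r) (a : ℕ → ℂ) :
    IsMonicOfDegree (airySymbol r a) r := by
  refine (isMonicOfDegree_X_pow (R := ℂ) r).sub ?_
  refine lt_of_le_of_lt (natDegree_sum_le_of_forall_le (n := r - 1) _ _ fun m hm => ?_) (by omega)
  exact (natDegree_C_mul_X_pow_le _ _).trans (by have := Finset.mem_Ico.1 hm; omega)

theorem isMonicOfDegree_mulZ {r : ℕ} (hr : 2 ≤ r) (a : ℕ → ℂ) (x : ℂ) {K : ℂ[X]} {d : ℕ}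
    (hK : IsMonicOfDegree K d) : IsMonicOfDegree (mulZ r a x K) (d + r) := by
  have h := (isMonicOfDegree_airySymbol hr a).mul hK
  rw [add_comm r d] at h
  refine (h.sub ?_).sub ?_
  · refine (natDegree_smul_le x K).trans_lt ?_
    rw [hK.natDegree_eq]; omega
  · refine (natDegree_derivative_le K).trans_lt ?_
    rw [hK.natDegree_eq]; omega

theorem isMonicOfDegree_mulZ_pow {r : ℕ} (hr : 2 ≤ r) (a : ℕ → ℂ) (x : ℂ) (l s : ℕ) :
    IsMonicOfDegree ((mulZ r a x ^ s) (X ^ l)) (l + r * s) := by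
  induction s with
  | zero => simpa using isMonicOfDegree_X_pow (R := ℂ) l
  | succ s ih =>
    rw [pow_succ', Module.End.mul_apply, mul_add, mul_one, ← add_assoc]
    exact isMonicOfDegree_mulZ hr a x ih

theorem natDegree_aeval_mulZ_lt {r n l : ℕ} (hr : 2 ≤ r) (hn : 1 ≤ n) (a : ℕ → ℂ) (x : ℂ)
    {e : ℂ[X]} (he : e.degree < n) (hl : l < r) :
    (aeval (mulZ r a x) e (X ^ l)).natDegree < r * n := by
  have hN : 0 < r * n := by positivity
  have he' : e.natDegree < n := by
    rcases eq_or_ne e 0 with rfl | h0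
    · simpa [Nat.pos_iff_ne_zero] using Nat.one_le_iff_ne_zero.1 hn
    · exact (natDegree_lt_iff_degree_lt h0).2 he
  rw [aeval_eq_sum_range' he', LinearMap.sum_apply]
  refine lt_of_le_of_lt (natDegree_sum_le_of_forall_le (n := r * n - 1) _ _ fun s hs => ?_)
    (by omega)
  refine (natDegree_smul_le _ _).trans ?_
  rw [(isMonicOfDegree_mulZ_pow hr a x l s).natDegree_eq]
  have hs' := Finset.mem_range.1 hs
  have : r * (s + 1) ≤ r * n := Nat.mul_le_mul_left r hs'
  rw [mul_add] at this
  omega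

/-- The combination `q(z) g(x+z) + ∑_l e_l(z) g^{(l)}(x+z)`. -/
noncomputable def bakerFun (r : ℕ) (g : ℂ → ℂ) (x : ℂ) (q : ℂ[X]) (e : ℕ → ℂ[X]) (z : ℂ) : ℂ :=
  q.eval z * g (x + z) + ∑ l ∈ Finset.range r, (e l).eval z * iteratedDeriv l g (x + z)

theorem exists_evalOp_eq_bakerFun {r n : ℕ} (hr : 2 ≤ r) (hn : 1 ≤ n) (a : ℕ → ℂ) (x : ℂ)
    {q : ℂ[X]} (hq : IsMonicOfDegree q n) {e : ℕ → ℂ[X]} (he : ∀ l < r, (e l).degree < n) :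
    ∃ K : ℂ[X], IsMonicOfDegree K (r * n) ∧
      ∀ g, IsAiry r a g → ∀ z, evalOp g (x + z) K = bakerFun r g x q e z := by
  refine ⟨aeval (mulZ r a x) q (X ^ 0)
    + ∑ l ∈ Finset.range r, aeval (mulZ r a x) (e l) (X ^ l), ?_, fun g hg z => ?_⟩
  · refine IsMonicOfDegree.add_right ?_ ?_
    · obtain ⟨p, hp, rfl⟩ : ∃ p : ℂ[X], p.degree < n ∧ q = X ^ n + p := by
        refine ⟨q - X ^ n, ?_, by ring⟩
        have := degree_sub_lt_left (p := q) (q := X ^ n)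
          (by rw [degree_X_pow, degree_eq_natDegree hq.ne_zero, hq.natDegree_eq]) hq.ne_zero
          (by rw [hq.monic.leadingCoeff, (monic_X_pow n).leadingCoeff])
        rwa [degree_eq_natDegree hq.ne_zero, hq.natDegree_eq] at this
      rw [map_add, LinearMap.add_apply]
      refine IsMonicOfDegree.add_right ?_ (natDegree_aeval_mulZ_lt hr hn a x hp (by omega))
      simpa using isMonicOfDegree_mulZ_pow hr a x 0 n
    · refine lt_of_le_of_lt (natDegree_sum_le_of_forall_le (n := r * n - 1) _ _ fun l hl => ?_) ?_
      · have := natDegree_aeval_mulZ_lt hr hn a x (he l (Finset.mem_range.1 hl))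
          (Finset.mem_range.1 hl)
        omega
      · have : 0 < r * n := by positivity
        omega
  · simp only [map_add, map_sum, evalOp_aeval_mulZ hg, evalOp_X_pow, iteratedDeriv_zero, bakerFun]

/-- Triangular row operations do not change a Wronskian. -/
theorem wrDet_eq_det_evalOp (m : ℕ) (g : Fin m → ℂ → ℂ) (x : ℂ) (K : Fin m → ℂ[X])
    (hK : ∀ i, IsMonicOfDegree (K i) i) :
    wrDet m g x = (Matrix.of fun k s => evalOp (g s) x (K k)).det := by
  have h : (Matrix.of fun k s => evalOp (g s) x (K k))
      = (Matrix.of fun i j : Fin m => (K j).coeff i)ᵀ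
        * Matrix.of fun k s : Fin m => iteratedDeriv k.val (g s) x := by
    ext k s
    rw [Matrix.of_apply, evalOp_eq_sum _ _ (by rw [(hK k).natDegree_eq]; exact k.2),
      Finset.sum_range, Matrix.mul_apply]
    rfl
  rw [h, det_mul, det_transpose, det_matrixOfPolynomials K (fun i => (hK i).natDegree_eq)
    (fun i => (hK i).monic), one_mul]
  rfl

theorem wrDetB_eq_mul_evalOp {m : ℕ} (g : Fin m → ℂ → ℂ) (u : ℂ → ℂ) (x : ℂ) {K : ℂ[X]}
    (hK : IsMonicOfDegree K m) (h0 : ∀ s, evalOp (g s) x K = 0) :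
    wrDetB m g u x = wrDet m g x * evalOp u x K := by
  unfold wrDetB
  rw [wrDet_eq_det_evalOp (m + 1) _ x (Fin.snoc (fun k : Fin m => (X : ℂ[X]) ^ k.val) K)
    (fun i => by
      refine Fin.lastCases ?_ (fun i => ?_) i
      · simpa using hK
      · simpa using isMonicOfDegree_X_pow (R := ℂ) i.val),
    det_succ_row _ (Fin.last m), Fin.sum_univ_castSucc]
  have e : ∀ s : Fin m, (Matrix.of fun k s => evalOp ((Fin.snoc g u : Fin (m + 1) → ℂ → ℂ) s) x
      ((Fin.snoc (fun k : Fin m => (X : ℂ[X]) ^ k.val) K : Fin (m + 1) → ℂ[X]) k))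
      (Fin.last m) s.castSucc = 0 := fun s => by simpa using h0 s
  simp only [e, mul_zero, zero_mul, Finset.sum_const_zero, zero_add]
  simp only [Matrix.of_apply, Fin.snoc_last, Fin.val_last, ← two_mul, pow_mul, neg_one_sq, one_pow,
    one_mul]
  rw [mul_comm]
  congr 1
  unfold wrDet
  congr 1
  ext k s
  simp [Fin.succAbove_last, evalOp_X_pow]

theorem phiFam_evalOp {r n : ℕ} {f : ℕ → ℂ → ℂ} (hf : ∀ j < r, Differentiable ℂ (f j))
    (lam gam : ℕ → ℂ) (x : ℂ) (K : ℂ[X]) (s : Fin (r * n)) :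
    evalOp (phiFam r n f lam gam s) x K
      = gam (s.val / r) * evalOp (f (s.val % r)) (x + lam (s.val / r)) K
        + evalOp (deriv (f (s.val % r))) (x + lam (s.val / r)) K := by
  have hr : 0 < r := Nat.pos_of_ne_zero fun h => by subst h; exact absurd s.2 (by simp)
  have hg := hf _ (Nat.mod_lt s.val hr)
  have hg' : Differentiable ℂ (deriv (f (s.val % r))) := by
    simpa using hg.iteratedDeriv_complex 1
  set g := f (s.val % r)
  set l := lam (s.val / r)
  set c := gam (s.val / r)
  have h : ∀ k : ℕ, iteratedDeriv k (phiFam r n f lam gam s) x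
      = c * iteratedDeriv k g (x + l) + iteratedDeriv k (deriv g) (x + l) := fun k => by
    have e : phiFam r n f lam gam s = (fun t => c * g (t + l)) + fun t => deriv g (t + l) := rfl
    have d1 : Differentiable ℂ fun t => g (t + l) := by fun_prop
    have d2 : Differentiable ℂ fun t => deriv g (t + l) := hg'.comp (by fun_prop)
    rw [e, iteratedDeriv_add ((d1.const_mul c).contDiff_complex k).contDiffAt
      (d2.contDiff_complex k).contDiffAt, iteratedDeriv_const_mul_field,
      iteratedDeriv_comp_add_const, iteratedDeriv_comp_add_const]
  simp only [evalOp_eq_sum _ _ (Nat.lt_succ_self K.natDegree), h, Finset.mul_sum,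
    ← Finset.sum_add_distrib]
  exact Finset.sum_congr rfl fun k _ => by ring

/-- If `bakerFun` satisfies the interpolation conditions at the `λ_i`, it computes the bordered
Wronskian. -/
theorem wrDetB_eq_mul_bakerFun {r n : ℕ} {a : ℕ → ℂ} {f : ℕ → ℂ → ℂ} (hr : 2 ≤ r) (hn : 1 ≤ n)
    (hf : ∀ j < r, IsAiry r a (f j)) (lam gam : ℕ → ℂ) (x : ℂ) {q : ℂ[X]}
    (hq : IsMonicOfDegree q n) {e : ℕ → ℂ[X]} (he : ∀ l < r, (e l).degree < n)
    (hcond : ∀ i < n, ∀ j < r, deriv (bakerFun r (f j) x q e) (lam i)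
      + gam i * bakerFun r (f j) x q e (lam i) = 0)
    {g : ℂ → ℂ} (hg : IsAiry r a g) (z : ℂ) :
    wrDetB (r * n) (phiFam r n f lam gam) (fun t => g (t + z)) x
      = wrDet (r * n) (phiFam r n f lam gam) x * bakerFun r g x q e z := by
  obtain ⟨K, hK, hKe⟩ := exists_evalOp_eq_bakerFun hr hn a x hq he
  rw [wrDetB_eq_mul_evalOp _ _ _ hK, evalOp_shift, hKe g hg z]
  intro s
  rw [phiFam_evalOp fun j hj => (hf j hj).diff]
  have hj : s.val % r < r := Nat.mod_lt _ (by omega)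
  have hi : s.val / r < n := Nat.div_lt_of_lt_mul s.2
  have h := hcond _ hi _ hj
  have e : bakerFun r (f (s.val % r)) x q e = fun z => evalOp (f (s.val % r)) (x + z) K :=
    funext fun z => (hKe _ (hf _ hj) z).symm
  rw [e, (hasDerivAt_evalOp (hf _ hj).diff x _ K).deriv] at h
  rw [add_comm]
  exact h

/-- The coefficient of `∂^l` in the companion system of `L₀`. -/
noncomputable def airyCoeff (r : ℕ) (a : ℕ → ℂ) (l : ℕ) : ℂ :=
  if 1 ≤ l ∧ l < r - 1 then a l else 0

/-- The coefficient of `g^{(l)}(x+λ)` in `(∂_z + γ) ∑_k e_k(z) g^{(k)}(x+z)` at `z = λ`. -/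
noncomputable def bakerCoeff (r : ℕ) (a : ℕ → ℂ) (lam gam x : ℂ) (e : ℕ → ℂ[X]) (l : ℕ) : ℂ :=
  (e l).derivative.eval lam + gam * (e l).eval lam
    + (if l = 0 then (x + lam) * (e (r - 1)).eval lam else (e (l - 1)).eval lam)
    + airyCoeff r a l * (e (r - 1)).eval lam

theorem hasDerivAt_bakerFun (r : ℕ) {g : ℂ → ℂ} (hg : Differentiable ℂ g)
    (x : ℂ) (q : ℂ[X]) (e : ℕ → ℂ[X]) (z : ℂ) :
    HasDerivAt (bakerFun r g x q e)
      ((q.derivative.eval z * g (x + z) + q.eval z * iteratedDeriv 1 g (x + z))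
        + ∑ l ∈ Finset.range r, ((e l).derivative.eval z * iteratedDeriv l g (x + z)
          + (e l).eval z * iteratedDeriv (l + 1) g (x + z))) z := by
  have h0 := (q.hasDerivAt z).mul (hg.hasDerivAt_iteratedDeriv_shift 0 x z)
  have h1 := HasDerivAt.fun_sum (u := Finset.range r) fun l _ =>
    ((e l).hasDerivAt z).mul (hg.hasDerivAt_iteratedDeriv_shift l x z)
  simp only [iteratedDeriv_zero, zero_add] at h0
  exact h0.add h1

theorem deriv_bakerFun_add {r : ℕ} {a : ℕ → ℂ} {g : ℂ → ℂ} (hr : 2 ≤ r) (hg : IsAiry r a g)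
    (x lam gam : ℂ) {q : ℂ[X]} (hq : q.eval lam = 0) (e : ℕ → ℂ[X]) :
    deriv (bakerFun r g x q e) lam + gam * bakerFun r g x q e lam
      = q.derivative.eval lam * g (x + lam)
        + ∑ l ∈ Finset.range r, bakerCoeff r a lam gam x e l * iteratedDeriv l g (x + lam) := by
  rw [(hasDerivAt_bakerFun r hg.diff x q e lam).deriv, bakerFun, hq]
  obtain ⟨R, rfl⟩ : ∃ R, r = R + 1 := ⟨r - 1, by omega⟩
  simp only [bakerCoeff, add_mul, Finset.sum_add_distrib, Nat.add_sub_cancel]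
  have h1 : ∑ l ∈ Finset.range (R + 1), (e l).eval lam * iteratedDeriv (l + 1) g (x + lam)
      = ∑ l ∈ Finset.range (R + 1), (if l = 0 then (x + lam) * (e R).eval lam
          else (e (l - 1)).eval lam) * iteratedDeriv l g (x + lam)
        + ∑ l ∈ Finset.range (R + 1), airyCoeff (R + 1) a l * (e R).eval lam
          * iteratedDeriv l g (x + lam) := by
    have h2 : ∑ l ∈ Finset.range (R + 1), airyCoeff (R + 1) a l * (e R).eval lam
          * iteratedDeriv l g (x + lam)
        = (e R).eval lam * ∑ m ∈ Finset.Ico 1 R, a m * iteratedDeriv m g (x + lam) := by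
      have h3 : Finset.Ico 1 R = (Finset.range (R + 1)).filter fun l => 1 ≤ l ∧ l < R := by
        ext l; simp; omega
      rw [h3, Finset.sum_filter, Finset.mul_sum]
      refine Finset.sum_congr rfl fun l _ => ?_
      simp only [airyCoeff, Nat.add_sub_cancel]
      split_ifs <;> ring
    rw [h2, Finset.sum_range_succ, Finset.sum_range_succ', hg.iteratedDeriv_eq]
    simp
    ring
  rw [h1, mul_add, Finset.mul_sum]
  simp only [mul_assoc]
  ring_nf

theorem bakerCoeff_sum {ι : Type*} (s : Finset ι) (r : ℕ) (a : ℕ → ℂ) (lam gam x : ℂ) (v : ι → ℂ)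
    (e : ι → ℕ → ℂ[X]) (l : ℕ) :
    bakerCoeff r a lam gam x (fun l => ∑ m ∈ s, C (v m) * e m l) l
      = ∑ m ∈ s, v m * bakerCoeff r a lam gam x (e m) l := by
  by_cases h : l = 0 <;>
  · simp only [bakerCoeff, h, if_true, if_false, derivative_sum, derivative_C_mul,
      eval_finsetSum, eval_mul, eval_C, Finset.mul_sum, ← Finset.sum_add_distrib]
    exact Finset.sum_congr rfl fun m _ => by ring

/-- The family with the single monomial `z^(m/r)` in position `m % r`. -/
noncomputable def unitFam (r m : ℕ) (l : ℕ) : ℂ[X] := if l = m % r then X ^ (m / r) else 0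

theorem bakerFun_unitFam {r : ℕ} (hr : 0 < r) (g : ℂ → ℂ) (x : ℂ) (m : ℕ) (z : ℂ) :
    bakerFun r g x 0 (unitFam r m) z = z ^ (m / r) * iteratedDeriv (m % r) g (x + z) := by
  rw [bakerFun, Finset.sum_eq_single (m % r)]
  · simp [unitFam]
  · intro l _ hl; simp [unitFam, hl]
  · intro h; exact absurd (Finset.mem_range.2 (Nat.mod_lt _ hr)) h

/-- Pairs `(l, i)` are listed as `l + r * i`. -/
def blockEquiv (r n : ℕ) : Fin r × Fin n ≃ Fin (r * n) :=
  (Equiv.prodComm _ _).trans (finProdFinEquiv.trans (finCongr (mul_comm n r)))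

theorem blockEquiv_val {r n : ℕ} (p : Fin r × Fin n) :
    (blockEquiv r n p).val = p.1.val + r * p.2.val := rfl

theorem blockEquiv_mod {r n : ℕ} (p : Fin r × Fin n) : (blockEquiv r n p).val % r = p.1.val := by
  rw [blockEquiv_val, Nat.add_mul_mod_self_left, Nat.mod_eq_of_lt p.1.2]

theorem blockEquiv_div {r n : ℕ} (p : Fin r × Fin n) : (blockEquiv r n p).val / r = p.2.val := by
  have hr : 0 < r := p.1.pos
  rw [blockEquiv_val, Nat.add_mul_div_left _ _ hr, Nat.div_eq_of_lt p.1.2, zero_add]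

/-- The matrix of interpolation conditions, in the basis of monomial families. -/
noncomputable def condMatrix (r n : ℕ) (a lam gam : ℕ → ℂ) (x : ℂ) :
    Matrix (Fin (r * n)) (Fin (r * n)) ℂ :=
  Matrix.of fun m t => bakerCoeff r a (lam (t.val / r)) (gam (t.val / r)) x (unitFam r m.val)
    (t.val % r)

theorem det_block_wronskian {r n : ℕ} {f : ℕ → ℂ → ℂ}
    (hwrf : ∀ x : ℂ, wrDet r (fun j => f j.val) x = 1) (lam : ℕ → ℂ) (x : ℂ) :
    (Matrix.of fun t s : Fin (r * n) => if t.val / r = s.val / r then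
      iteratedDeriv (t.val % r) (f (s.val % r)) (x + lam (t.val / r)) else 0).det = 1 := by
  rw [← det_submatrix_equiv_self (blockEquiv r n)]
  have : (Matrix.of fun t s : Fin (r * n) => if t.val / r = s.val / r then
      iteratedDeriv (t.val % r) (f (s.val % r)) (x + lam (t.val / r)) else 0).submatrix
        (blockEquiv r n) (blockEquiv r n)
      = blockDiagonal fun i : Fin n => Matrix.of fun k s : Fin r =>
        iteratedDeriv k.val (f s.val) (x + lam i.val) := by
    ext p p'
    simp only [submatrix_apply, Matrix.of_apply, blockEquiv_div, blockEquiv_mod,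
      blockDiagonal_apply, Fin.ext_iff]
  rw [this, det_blockDiagonal]
  exact Finset.prod_eq_one fun i _ => hwrf _

theorem wrDet_eq_det_condMatrix {r n : ℕ} {a : ℕ → ℂ} {f : ℕ → ℂ → ℂ} (hr : 2 ≤ r)
    (hf : ∀ j < r, IsAiry r a (f j)) (hwrf : ∀ x : ℂ, wrDet r (fun j => f j.val) x = 1)
    (lam gam : ℕ → ℂ) (x : ℂ) :
    wrDet (r * n) (phiFam r n f lam gam) x = (condMatrix r n a lam gam x).det := by
  rw [← mul_one (condMatrix r n a lam gam x).det, ← det_block_wronskian (n := n) hwrf lam x,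
    ← det_mul, wrDet_eq_det_evalOp _ _ x (fun m => (mulZ r a x ^ (m.val / r)) (X ^ (m.val % r)))]
  · congr 1
    ext m s
    have hj : s.val % r < r := Nat.mod_lt _ (by omega)
    have hs := hf _ hj
    have e : (fun z => evalOp (f (s.val % r)) (x + z)
        ((mulZ r a x ^ (m.val / r)) (X ^ (m.val % r))))
        = bakerFun r (f (s.val % r)) x 0 (unitFam r m.val) := by
      funext z
      have := evalOp_aeval_mulZ hs x z (X ^ (m.val / r)) (X ^ (m.val % r))
      rw [bakerFun_unitFam (by omega)]
      simpa [evalOp_X_pow] using this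
    have h1 := (hasDerivAt_evalOp hs.diff x (lam (s.val / r))
      ((mulZ r a x ^ (m.val / r)) (X ^ (m.val % r)))).deriv
    rw [e] at h1
    have h2 := deriv_bakerFun_add hr hs x (lam (s.val / r)) (gam (s.val / r)) (q := 0) (by simp)
      (unitFam r m.val)
    rw [h1, ← e] at h2
    rw [Matrix.of_apply, phiFam_evalOp fun j hj => (hf j hj).diff, add_comm, h2, Matrix.mul_apply,
      ← (blockEquiv r n).sum_comp, Fintype.sum_prod_type_right]
    have hi : s.val / r < n := Nat.div_lt_of_lt_mul s.2
    rw [Finset.sum_eq_single (⟨s.val / r, hi⟩ : Fin n)]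
    · simp [condMatrix, blockEquiv_div, blockEquiv_mod, Finset.sum_range]
    · intro i _ hne
      have hne' : i.val ≠ s.val / r := fun h => hne (Fin.ext h)
      simp [blockEquiv_div, hne']
    · simp
  · intro m
    have := isMonicOfDegree_mulZ_pow hr a x (m.val % r) (m.val / r)
    rwa [Nat.mod_add_div] at this

theorem natDegree_det_le_sum {ι : Type*} [Fintype ι] [DecidableEq ι] (M : Matrix ι ι ℂ[X])
    (b : ι → ℕ) (hM : ∀ i j, (M i j).natDegree ≤ b i) : M.det.natDegree ≤ ∑ i, b i := by
  rw [← det_transpose, det_apply]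
  refine natDegree_sum_le_of_forall_le _ _ fun σ _ => ?_
  refine (natDegree_smul_le _ _).trans ((natDegree_prod_le _ _).trans ?_)
  exact Finset.sum_le_sum fun i _ => hM _ _

theorem natDegree_adjugate_lt {n : ℕ} (M : Matrix (Fin n) (Fin n) ℂ) (i j : Fin n) :
    ((charmatrix M).adjugate i j).natDegree < n := by
  rw [adjugate_apply]
  refine lt_of_le_of_lt (natDegree_det_le_sum _ (fun k => if k = j then 0 else 1)
    fun k l => ?_) ?_
  · rcases eq_or_ne k j with rfl | hk
    · rcases eq_or_ne l i with rfl | hl <;> simp [*]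
    · rw [updateRow_ne hk, if_neg hk]
      exact (charmatrix_apply_natDegree_le (M := M) k l).trans (by split_ifs <;> simp)
  · calc ∑ k, (if k = j then 0 else 1) < ∑ _k : Fin n, 1 :=
        Finset.sum_lt_sum (fun k _ => by split_ifs <;> simp) ⟨j, Finset.mem_univ _, by simp⟩
      _ = n := by simp

theorem exists_polynomial_det_condMatrix {r : ℕ} (hr : 0 < r) (n : ℕ) (a lam gam : ℕ → ℂ) :
    ∃ D : ℂ[X], D.natDegree ≤ n ∧ ∀ x, D.eval x = (condMatrix r n a lam gam x).det := by
  let M : Matrix (Fin (r * n)) (Fin (r * n)) ℂ[X] := Matrix.of fun m t =>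
    C (condMatrix r n a lam gam 0 m t)
      + C (if t.val % r = 0 then (unitFam r m.val (r - 1)).eval (lam (t.val / r)) else 0) * X
  refine ⟨M.det, ?_, fun x => ?_⟩
  · rw [← det_transpose]
    refine (natDegree_det_le_sum _ (fun t => if t.val % r = 0 then 1 else 0) fun t m => ?_).trans ?_
    · simp only [M, Matrix.transpose_apply, Matrix.of_apply]
      split_ifs
      · refine natDegree_add_le_of_degree_le (by simp) ?_
        exact (natDegree_C_mul_le _ _).trans natDegree_X_le
      · simp
    · rw [← (blockEquiv r n).sum_comp, Fintype.sum_prod_type_right]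
      simp only [blockEquiv_mod]
      refine le_of_eq ?_
      have : ∀ i : Fin n, ∑ l : Fin r, (if l.val = 0 then 1 else 0) = 1 := fun _ => by
        rw [Finset.sum_eq_single (⟨0, hr⟩ : Fin r)] <;> simp [Fin.ext_iff]
      rw [Finset.sum_congr rfl fun i _ => this i]
      simp
  · rw [← coe_evalRingHom, RingHom.map_det]
    congr 1
    ext m t
    simp only [M, RingHom.mapMatrix_apply, Matrix.map_apply, Matrix.of_apply, coe_evalRingHom,
      condMatrix, bakerCoeff]
    split_ifs
    · simp; ring
    · simp

/-- The node map `i ↦ λ_i` on `Fin n`. -/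
def node (n : ℕ) (lam : ℕ → ℂ) (i : Fin n) : ℂ := lam i

/-- The interpolation polynomial of degree `< n` with value `w i` at `λ_i`. -/
noncomputable abbrev interp (n : ℕ) (lam : ℕ → ℂ) (w : Fin n → ℂ) : ℂ[X] :=
  Lagrange.interpolate Finset.univ (node n lam) w

/-- Minus the matrix of `e ↦ e' + γ e` in terms of the values at the nodes. -/
noncomputable def derivMatrix (n : ℕ) (lam gam : ℕ → ℂ) : Matrix (Fin n) (Fin n) ℂ :=
  Matrix.of fun i m => -((Lagrange.basis Finset.univ (node n lam) m).derivative.eval (lam i)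
    + if i = m then gam i else 0)

/-- The recursion which solves the interpolation conditions of positive order. -/
noncomputable def recMatrix (r n : ℕ) (a lam gam : ℕ → ℂ) : ℕ → Matrix (Fin n) (Fin n) ℂ
  | 0 => 1
  | k + 1 => derivMatrix n lam gam * recMatrix r n a lam gam k - airyCoeff r a (r - 1 - k) • 1

/-- The matrix whose characteristic polynomial is proportional to `det Wr(φ)`. -/
noncomputable def specMatrix (r n : ℕ) (a lam gam : ℕ → ℂ) : Matrix (Fin n) (Fin n) ℂ :=
  recMatrix r n a lam gam r - diagonal (node n lam)

section Nodes

variable {r n : ℕ} {a lam : ℕ → ℂ}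

theorem eval_interp (hinj : Function.Injective (node n lam)) (w : Fin n → ℂ) (i : Fin n) :
    (interp n lam w).eval (lam i) = w i :=
  Lagrange.eval_interpolate_at_node w hinj.injOn (Finset.mem_univ i)

theorem degree_interp_lt (hinj : Function.Injective (node n lam)) (w : Fin n → ℂ) :
    (interp n lam w).degree < n := by
  simpa using Lagrange.degree_interpolate_lt w (s := Finset.univ) hinj.injOn

theorem derivative_eval_add (hinj : Function.Injective (node n lam)) (gam : ℕ → ℂ) {e : ℂ[X]}
    (he : e.degree < n) (i : Fin n) :
    e.derivative.eval (lam i) + gam i * e.eval (lam i)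
      = -(derivMatrix n lam gam *ᵥ fun m => e.eval (lam m)) i := by
  have h1 : e = ∑ m : Fin n, C (e.eval (lam m)) * Lagrange.basis Finset.univ (node n lam) m := by
    rw [← Lagrange.interpolate_apply Finset.univ (node n lam) fun m : Fin n => e.eval (lam m)]
    exact Lagrange.eq_interpolate hinj.injOn (by simpa using he)
  have h2 : e.derivative.eval (lam i)
      = ∑ m : Fin n, e.eval (lam m)
        * (Lagrange.basis Finset.univ (node n lam) m).derivative.eval (lam i) := by
    conv_lhs => rw [h1]
    simp [eval_finsetSum]
  rw [h2]
  simp only [derivMatrix, mulVec, dotProduct, Matrix.of_apply, neg_mul, Finset.sum_neg_distrib,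
    neg_neg, add_mul, ite_mul, zero_mul, Finset.sum_add_distrib, Finset.sum_ite_eq,
    Finset.mem_univ, if_true]
  exact congrArg₂ _ (Finset.sum_congr rfl fun m _ => mul_comm _ _) rfl

theorem bakerCoeff_eq (hinj : Function.Injective (node n lam)) (gam : ℕ → ℂ) (x : ℂ)
    {e : ℕ → ℂ[X]} {l : ℕ} (he : (e l).degree < n) (i : Fin n) :
    bakerCoeff r a (lam i) (gam i) x e l
      = -(derivMatrix n lam gam *ᵥ fun m => (e l).eval (lam m)) i
        + (if l = 0 then (x + lam i) * (e (r - 1)).eval (lam i) else (e (l - 1)).eval (lam i))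
        + airyCoeff r a l * (e (r - 1)).eval (lam i) := by
  rw [bakerCoeff, derivative_eval_add hinj gam he]

theorem recMatrix_succ_mulVec (gam : ℕ → ℂ) (k : ℕ) (w : Fin n → ℂ) :
    recMatrix r n a lam gam (k + 1) *ᵥ w
      = derivMatrix n lam gam *ᵥ (recMatrix r n a lam gam k *ᵥ w)
        - airyCoeff r a (r - 1 - k) • w := by
  rw [recMatrix, sub_mulVec, smul_mulVec, one_mulVec, mulVec_mulVec]

theorem scalar_sub_specMatrix_mulVec (hr : 0 < r) (gam : ℕ → ℂ) (x : ℂ) (w : Fin n → ℂ)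
    (i : Fin n) :
    ((Matrix.scalar (Fin n) x - specMatrix r n a lam gam) *ᵥ w) i
      = -(derivMatrix n lam gam *ᵥ (recMatrix r n a lam gam (r - 1) *ᵥ w)) i
        + (x + lam i) * w i := by
  obtain ⟨R, rfl⟩ : ∃ R, r = R + 1 := ⟨r - 1, by omega⟩
  have h0 : airyCoeff (R + 1) a 0 = 0 := by simp [airyCoeff]
  rw [specMatrix, sub_mulVec, sub_mulVec, recMatrix_succ_mulVec, scalar_apply]
  simp only [Nat.add_sub_cancel, Nat.sub_self, h0, zero_smul, sub_zero, Pi.sub_apply,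
    mulVec_diagonal, node]
  ring

/-- The family of polynomials that solves the interpolation conditions of positive order. -/
noncomputable def solFam (r n : ℕ) (a lam gam : ℕ → ℂ) (w : Fin n → ℂ) (l : ℕ) : ℂ[X] :=
  interp n lam (recMatrix r n a lam gam (r - 1 - l) *ᵥ w)

theorem bakerCoeff_solFam (hr : 0 < r) (hinj : Function.Injective (node n lam)) (gam : ℕ → ℂ)
    (x : ℂ) (w : Fin n → ℂ) {l : ℕ} (hl : l < r) (i : Fin n) :
    bakerCoeff r a (lam i) (gam i) x (solFam r n a lam gam w) l
      = if l = 0 then ((Matrix.scalar (Fin n) x - specMatrix r n a lam gam) *ᵥ w) i else 0 := by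
  rw [bakerCoeff_eq hinj gam x (degree_interp_lt hinj _)]
  simp only [solFam, eval_interp hinj]
  have h1 : recMatrix r n a lam gam (r - 1 - (r - 1)) = 1 := by rw [Nat.sub_self]; rfl
  rw [h1, one_mulVec]
  split_ifs with h
  · subst h
    rw [scalar_sub_specMatrix_mulVec hr]
    simp [airyCoeff]
  · have h2 : r - 1 - (l - 1) = r - 1 - l + 1 := by omega
    have h3 : r - 1 - (r - 1 - l) = l := by omega
    rw [h2, recMatrix_succ_mulVec, h3, Pi.sub_apply, Pi.smul_apply, smul_eq_mul]
    ring

theorem eval_of_bakerCoeff_eq_zero (hinj : Function.Injective (node n lam)) (gam : ℕ → ℂ) (x : ℂ)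
    {e : ℕ → ℂ[X]} (he : ∀ l < r, (e l).degree < n)
    (h : ∀ l < r, ∀ i : Fin n, bakerCoeff r a (lam i) (gam i) x e l = 0) (k : ℕ) (hk : k < r) :
    (fun i : Fin n => (e (r - 1 - k)).eval (lam i))
      = recMatrix r n a lam gam k *ᵥ fun i => (e (r - 1)).eval (lam i) := by
  induction k with
  | zero => simp [recMatrix]
  | succ k ih =>
    rw [recMatrix_succ_mulVec, ← ih (by omega)]
    funext i
    have h1 := h (r - 1 - k) (by omega) i
    have h2 : r - 1 - k ≠ 0 := by omega
    rw [bakerCoeff_eq hinj gam x (he _ (by omega)), if_neg h2] at h1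
    rw [Pi.sub_apply, Pi.smul_apply, smul_eq_mul, ← Nat.sub_sub]
    linear_combination h1

theorem charpoly_specMatrix_eval_eq_zero (hr : 0 < r)
    (hinj : Function.Injective (node n lam)) (gam : ℕ → ℂ) {x : ℂ}
    (hx : (condMatrix r n a lam gam x).det = 0) :
    (specMatrix r n a lam gam).charpoly.eval x = 0 := by
  obtain ⟨v, hv, hvA⟩ := exists_vecMul_eq_zero_iff.2 hx
  obtain ⟨e, he_def⟩ : ∃ e : ℕ → ℂ[X],
      e = fun l => ∑ m : Fin (r * n), C (v m) * unitFam r m.val l := ⟨_, rfl⟩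
  have hdeg : ∀ l, (e l).degree < n := fun l => by
    rw [he_def]
    refine (degree_sum_le _ _).trans_lt ((Finset.sup_lt_iff (WithBot.bot_lt_coe n)).2 fun m _ => ?_)
    have hm : m.val / r < n := Nat.div_lt_of_lt_mul m.2
    rw [unitFam]
    split_ifs
    · exact (degree_C_mul_X_pow_le _ _).trans_lt (Nat.cast_lt.2 hm)
    · simp
  have hzero : ∀ l < r, ∀ i : Fin n, bakerCoeff r a (lam i) (gam i) x e l = 0 := by
    intro l hl i
    have h1 := congrFun hvA (blockEquiv r n (⟨l, hl⟩, i))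
    rw [he_def, bakerCoeff_sum]
    simpa [vecMul, dotProduct, condMatrix, blockEquiv_mod, blockEquiv_div] using h1
  have hw := eval_of_bakerCoeff_eq_zero hinj gam x (fun l _ => hdeg l) hzero
  set w : Fin n → ℂ := fun i => (e (r - 1)).eval (lam i) with hw_def
  have hw0 : w ≠ 0 := by
    intro h0
    refine hv (funext fun m => ?_)
    have hmod : m.val % r < r := Nat.mod_lt _ hr
    have h1 : e (m.val % r) = 0 := by
      refine Polynomial.eq_zero_of_degree_lt_of_eval_index_eq_zero Finset.univ
        hinj.injOn (by simpa using hdeg _) fun i _ => ?_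
      have h2 := congrFun (hw (r - 1 - m.val % r) (by omega)) i
      rw [h0, mulVec_zero, Nat.sub_sub_self (by omega)] at h2
      exact h2
    have h3 : (e (m.val % r)).coeff (m.val / r) = v m := by
      rw [he_def, finsetSum_coeff, Finset.sum_eq_single m]
      · simp [unitFam]
      · intro m' _ hne
        rw [unitFam]
        split_ifs with h
        · rw [coeff_C_mul_X_pow, if_neg]
          intro h'
          exact hne (Fin.ext (by rw [← Nat.mod_add_div m'.val r, ← Nat.mod_add_div m.val r, h, h']))
        · simp
      · simp
    rw [← h3, h1]
    simp
  rw [eval_charpoly]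
  refine exists_mulVec_eq_zero_iff.1 ⟨w, hw0, funext fun i => ?_⟩
  rw [scalar_sub_specMatrix_mulVec hr, ← hw (r - 1) (by omega)]
  have h1 := hzero 0 hr i
  rw [bakerCoeff_eq hinj gam x (hdeg _), if_pos rfl] at h1
  simpa [airyCoeff] using h1

end Nodes

theorem eval_charmatrix_adjugate {n : ℕ} (Q : Matrix (Fin n) (Fin n) ℂ) (x : ℂ) (i j : Fin n) :
    ((charmatrix Q).adjugate i j).eval x = (Matrix.scalar (Fin n) x - Q).adjugate i j := by
  have h : (evalRingHom x).mapMatrix (charmatrix Q) = Matrix.scalar (Fin n) x - Q := by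
    ext k l
    obtain rfl | hkl := eq_or_ne k l <;> simp [charmatrix, *]
  rw [← h, ← RingHom.map_adjugate]
  simp

theorem exists_polynomial_adjugate {n : ℕ} (Q : Matrix (Fin n) (Fin n) ℂ) (u v : Fin n → ℂ) :
    ∃ D : ℂ[X], D.degree < n ∧
      ∀ x, D.eval x = u ⬝ᵥ ((Matrix.scalar (Fin n) x - Q).adjugate *ᵥ v) := by
  refine ⟨∑ i, ∑ j, C (u i * v j) * (charmatrix Q).adjugate i j, ?_, fun x => ?_⟩
  · have hb := WithBot.bot_lt_coe n
    refine (degree_sum_le _ _).trans_lt ((Finset.sup_lt_iff hb).2 fun i _ => ?_)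
    refine (degree_sum_le _ _).trans_lt ((Finset.sup_lt_iff hb).2 fun j _ => ?_)
    exact degree_le_natDegree.trans_lt (Nat.cast_lt.2
      ((natDegree_C_mul_le _ _).trans_lt (natDegree_adjugate_lt Q i j)))
  · simp only [eval_finsetSum, eval_mul, eval_C, eval_charmatrix_adjugate, dotProduct, mulVec,
      Finset.mul_sum]
    exact Finset.sum_congr rfl fun i _ => Finset.sum_congr rfl fun j _ => by ring

theorem isMonicOfDegree_nodal (n : ℕ) (mu : ℕ → ℂ) :
    IsMonicOfDegree (Lagrange.nodal (Finset.range n) mu) n :=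
  ⟨by simp [Lagrange.natDegree_nodal], Lagrange.nodal_monic⟩

theorem IsMonicOfDegree.eq_nodal {n : ℕ} {mu : ℕ → ℂ} {p : ℂ[X]} (hp : IsMonicOfDegree p n)
    (hmu : Set.InjOn mu (Finset.range n)) (h : ∀ k < n, p.eval (mu k) = 0) :
    p = Lagrange.nodal (Finset.range n) mu := by
  have hq := isMonicOfDegree_nodal n mu
  have hpd : p.degree = n := by rw [degree_eq_natDegree hp.ne_zero, hp.natDegree_eq]
  refine eq_of_degree_le_of_eval_index_eq _ hmu ?_ ?_ ?_ fun k hk => ?_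
  · simp [hpd]
  · rw [hpd, Lagrange.degree_nodal, Finset.card_range]
  · rw [hp.leadingCoeff_eq, hq.leadingCoeff_eq]
  · rw [h k (Finset.mem_range.1 hk), Lagrange.eval_nodal_at_node hk]

theorem eq_C_mul_nodal {n : ℕ} {mu : ℕ → ℂ} {p : ℂ[X]} (hp : p.natDegree ≤ n)
    (hmu : Set.InjOn mu (Finset.range n)) (h : ∀ k < n, p.eval (mu k) = 0) :
    p = C (p.coeff n) * Lagrange.nodal (Finset.range n) mu := by
  have hq := isMonicOfDegree_nodal n mu
  refine eq_of_degree_sub_lt_of_eval_index_eq _ hmu ?_ fun k hk => ?_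
  · rw [Finset.card_range, degree_lt_iff_coeff_zero]
    intro m hm
    rw [coeff_sub, coeff_C_mul]
    rcases hm.eq_or_lt with rfl | hm
    · rw [((isMonicOfDegree_iff _ _).1 hq).2, mul_one, sub_self]
    · rw [coeff_eq_zero_of_natDegree_lt (hp.trans_lt hm),
        coeff_eq_zero_of_natDegree_lt (hq.natDegree_eq.trans_lt hm), mul_zero, sub_self]
  · rw [h k (Finset.mem_range.1 hk), eval_mul, Lagrange.eval_nodal_at_node hk, mul_zero]

theorem continuous_wrDet {m : ℕ} {g : Fin m → ℂ → ℂ} (hg : ∀ s, Differentiable ℂ (g s)) :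
    Continuous (wrDet m g) := by
  unfold wrDet
  exact Continuous.matrix_det (continuous_matrix fun k s =>
    ((hg s).iteratedDeriv_complex k).continuous)

theorem continuous_wrDetB {m : ℕ} {g : Fin m → ℂ → ℂ} (hg : ∀ s, Differentiable ℂ (g s))
    {u : ℂ → ℂ} (hu : Differentiable ℂ u) : Continuous (wrDetB m g u) := by
  refine continuous_wrDet fun s => ?_
  induction s using Fin.lastCases with
  | last => simpa using hu
  | cast s => simpa using hg s

theorem differentiable_phiFam {r n : ℕ} (hr : 0 < r) {f : ℕ → ℂ → ℂ}
    (hf : ∀ j < r, Differentiable ℂ (f j)) (lam gam : ℕ → ℂ) (k : Fin (r * n)) :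
    Differentiable ℂ (phiFam r n f lam gam k) := by
  have h := hf _ (Nat.mod_lt k.val hr)
  have h' : Differentiable ℂ (deriv (f (k.val % r))) := by
    simpa using h.iteratedDeriv_complex 1
  unfold phiFam
  have hs : Differentiable ℂ fun x : ℂ => x + lam (k.val / r) := differentiable_id.add_const _
  exact ((h.comp hs).const_mul _).add (h'.comp hs)

theorem continuous_bakerFun (r : ℕ) {g : ℂ → ℂ} (hg : Differentiable ℂ g) (x : ℂ) (q : ℂ[X])
    (e : ℕ → ℂ[X]) : Continuous (bakerFun r g x q e) :=
  continuous_iff_continuousAt.2 fun z => (hasDerivAt_bakerFun r hg x q e z).continuousAt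

theorem solFam_smul (r n : ℕ) (a lam gam : ℕ → ℂ) (c : ℂ) (w : Fin n → ℂ) (l : ℕ) :
    solFam r n a lam gam (c • w) l = c • solFam r n a lam gam w l := by
  rw [solFam, mulVec_smul, interp, map_smul, solFam]

theorem eval_solFam (r n : ℕ) (a lam gam : ℕ → ℂ) (w : Fin n → ℂ) (l : ℕ) (z : ℂ) :
    (solFam r n a lam gam w l).eval z
      = ((fun m => (Lagrange.basis Finset.univ (node n lam) m).eval z)
          ᵥ* recMatrix r n a lam gam (r - 1 - l)) ⬝ᵥ w := by
  rw [← dotProduct_mulVec, solFam, interp, Lagrange.interpolate_apply, eval_finsetSum]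
  exact Finset.sum_congr rfl fun m _ => by rw [eval_mul, eval_C, mul_comm]

section Dual

variable {r n : ℕ} {a lam gam : ℕ → ℂ} {f : ℕ → ℂ → ℂ}

theorem wrDetB_eq_solFam (hr : 2 ≤ r) (hn : 1 ≤ n) (hf : ∀ j < r, IsAiry r a (f j))
    (hlam : Set.InjOn lam (Finset.range n)) {x : ℂ}
    (hx : (specMatrix r n a lam gam).charpoly.eval x ≠ 0) {g : ℂ → ℂ} (hg : IsAiry r a g) (z : ℂ) :
    (specMatrix r n a lam gam).charpoly.eval x
        * wrDetB (r * n) (phiFam r n f lam gam) (fun t => g (t + z)) x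
      = wrDet (r * n) (phiFam r n f lam gam) x
        * ((Lagrange.nodal (Finset.range n) lam).eval z
            * (specMatrix r n a lam gam).charpoly.eval x * g (x + z)
          + ∑ l ∈ Finset.range r, (solFam r n a lam gam
              ((Matrix.scalar (Fin n) x - specMatrix r n a lam gam).adjugate *ᵥ
                fun i => -(Lagrange.nodal (Finset.range n) lam).derivative.eval (lam i)) l).eval z
            * iteratedDeriv l g (x + z)) := by
  have hinj : Function.Injective (node n lam) := fun i j hij =>
    Fin.ext (hlam (by simp) (by simp) hij)
  set Q := specMatrix r n a lam gam with hQ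
  set q := Lagrange.nodal (Finset.range n) lam with hq
  set v : Fin n → ℂ := fun i => -q.derivative.eval (lam i) with hv
  set w := (Matrix.scalar (Fin n) x - Q).adjugate *ᵥ v with hw
  set T := Q.charpoly.eval x with hT
  have hsolve : (Matrix.scalar (Fin n) x - Q) *ᵥ (T⁻¹ • w) = v := by
    rw [mulVec_smul, hw, mulVec_mulVec, mul_adjugate, ← eval_charpoly, smul_mulVec, one_mulVec,
      smul_smul, inv_mul_cancel₀ hx, one_smul]
  rw [wrDetB_eq_mul_bakerFun hr hn hf lam gam x (isMonicOfDegree_nodal n lam)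
    (e := solFam r n a lam gam (T⁻¹ • w)) (fun l _ => degree_interp_lt hinj _) _ hg z, ← hq,
    mul_left_comm]
  · congr 1
    simp only [bakerFun, solFam_smul, eval_smul, smul_eq_mul, mul_add, Finset.mul_sum]
    congr 1
    · ring
    · exact Finset.sum_congr rfl fun l _ => by rw [← mul_assoc, mul_inv_cancel_left₀ hx]
  · intro i hi j hj
    rw [deriv_bakerFun_add hr (hf j hj) x _ _
      (Lagrange.eval_nodal_at_node (Finset.mem_range.2 hi)), Finset.sum_eq_single 0]
    · have h := bakerCoeff_solFam (r := r) (a := a) (by omega) hinj gam x (T⁻¹ • w) (l := 0)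
        (by omega) ⟨i, hi⟩
      rw [if_pos rfl, ← hQ, hsolve] at h
      simp only at h
      rw [h, iteratedDeriv_zero, hv]
      ring
    · intro l hl hl0
      have h := bakerCoeff_solFam (r := r) (a := a) (by omega) hinj gam x (T⁻¹ • w)
        (Finset.mem_range.1 hl) ⟨i, hi⟩
      rw [if_neg hl0] at h
      simp only at h
      rw [h, zero_mul]
    · intro h
      exact absurd (Finset.mem_range.2 (by omega)) h

/-- As a function of the base point `x`, the bordered Wronskian is a Baker function again. -/
theorem exists_wrDetB_eq_mul_bakerFun (hr : 2 ≤ r) (hn : 1 ≤ n) (hf : ∀ j < r, IsAiry r a (f j))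
    (hlam : Set.InjOn lam (Finset.range n)) {c : ℂ}
    (hc : ∀ x, wrDet (r * n) (phiFam r n f lam gam) x
      = c * (specMatrix r n a lam gam).charpoly.eval x)
    {z : ℂ} (hz : (Lagrange.nodal (Finset.range n) lam).eval z ≠ 0) :
    ∃ D : ℕ → ℂ[X], (∀ l, (D l).degree < n) ∧ ∀ g, IsAiry r a g → ∀ x,
      wrDetB (r * n) (phiFam r n f lam gam) (fun t => g (t + z)) x
        = c * (Lagrange.nodal (Finset.range n) lam).eval z
          * bakerFun r g z (specMatrix r n a lam gam).charpoly D x := by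
  set Q := specMatrix r n a lam gam with hQ
  set q := Lagrange.nodal (Finset.range n) lam with hq
  choose D hdeg hD using fun l => exists_polynomial_adjugate Q
    ((q.eval z)⁻¹ • ((fun m => (Lagrange.basis Finset.univ (node n lam) m).eval z)
          ᵥ* recMatrix r n a lam gam (r - 1 - l))) (fun i => -q.derivative.eval (lam i))
  refine ⟨D, hdeg, fun g hg => ?_⟩
  have hdense : Dense {x : ℂ | Q.charpoly.eval x ≠ 0} := by
    refine ((Q.charpoly.roots.toFinset.finite_toSet).countable.dense_compl ℝ).mono fun x hx => ?_
    simpa [Q.charpoly_monic.ne_zero] using hx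
  have hgz : Differentiable ℂ fun t => g (t + z) := hg.diff.comp (differentiable_id.add_const z)
  refine congrFun (Continuous.ext_on hdense
    (continuous_wrDetB (differentiable_phiFam (by omega) (fun j hj => (hf j hj).diff) lam gam) hgz)
    (continuous_const.mul (continuous_bakerFun r hg.diff z _ D)) fun x hx => ?_)
  refine mul_left_cancel₀ hx ?_
  rw [wrDetB_eq_solFam hr hn hf hlam hx hg z, hc, bakerFun, add_comm z x]
  simp only [hD, eval_solFam, smul_dotProduct, smul_eq_mul, ← hq, ← hQ]
  simp only [mul_assoc, ← Finset.mul_sum]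
  field_simp

end Dual

end Bispectral

theorem statement6 (r n : ℕ) (a : ℕ → ℂ) (f : ℕ → ℂ → ℂ) (lam gam : ℕ → ℂ)
    (hr : 2 ≤ r) (hn : 1 ≤ n)
    (hf : ∀ j < r, Differentiable ℂ (f j))
    (hker : ∀ j < r, ∀ x : ℂ, airyOp r a (f j) x = 0)
    (hwrf : ∀ x : ℂ, wrDet r (fun j => f j.val) x = 1)
    (hlam : ∀ i < n, ∀ j < n, i ≠ j → lam i ≠ lam j)
    (mu gam' : ℕ → ℂ)
    (hmu : ∀ k < n, ∀ l < n, k ≠ l → mu k ≠ mu l)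
    (hroots : ∀ x : ℂ, wrDet (r * n) (phiFam r n f lam gam) x = 0 ↔ ∃ k < n, x = mu k)
    (hgam' : ∀ k < n, ∀ u : ℂ → ℂ, Differentiable ℂ u →
      deriv (wrDetB (r * n) (phiFam r n f lam gam) u) (mu k)
        + gam' k * wrDetB (r * n) (phiFam r n f lam gam) u (mu k) = 0)
    (fb : ℂ → ℂ)
    (hfb : fb ∈ Submodule.span ℂ (Set.range fun j : Fin r => f j.val)) :
    ∀ x z : ℂ,
      wrDet (r * n) (phiFam r n f lam gam) x ≠ 0 →
      wrDet (r * n) (phiFam r n f mu gam') z ≠ 0 →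
      (∏ i ∈ Finset.range n, (z - lam i)) ≠ 0 →
      (∏ k ∈ Finset.range n, (x - mu k)) ≠ 0 →
      wrDetB (r * n) (phiFam r n f lam gam) (fun t => fb (t + z)) x /
          (wrDet (r * n) (phiFam r n f lam gam) x * ∏ i ∈ Finset.range n, (z - lam i))
        = wrDetB (r * n) (phiFam r n f mu gam') (fun t => fb (t + x)) z /
            (wrDet (r * n) (phiFam r n f mu gam') z * ∏ k ∈ Finset.range n, (x - mu k)) := by
  have hA : ∀ j < r, IsAiry r a (f j) := fun j hj => ⟨hf j hj, hker j hj⟩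
  have hfbA : IsAiry r a fb := IsAiry.of_mem_span (by rintro _ ⟨j, rfl⟩; exact hA j j.2) hfb
  have hlam' : Set.InjOn lam (Finset.range n) := fun i hi j hj h => by
    by_contra hne
    exact hlam i (by simpa using hi) j (by simpa using hj) hne h
  have hmu' : Set.InjOn mu (Finset.range n) := fun i hi j hj h => by
    by_contra hne
    exact hmu i (by simpa using hi) j (by simpa using hj) hne h
  have hinj : Function.Injective (node n lam) := fun i j hij =>
    Fin.ext (hlam' (by simp) (by simp) hij)
  have hdet := wrDet_eq_det_condMatrix (n := n) hr hA hwrf lam gam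
  have hdet0 : ∀ k < n, (condMatrix r n a lam gam (mu k)).det = 0 := fun k hk => by
    rw [← hdet, hroots]
    exact ⟨k, hk, rfl⟩
  have hchar : (specMatrix r n a lam gam).charpoly = Lagrange.nodal (Finset.range n) mu :=
    IsMonicOfDegree.eq_nodal
      ⟨by simp, Matrix.charpoly_monic _⟩ hmu' fun k hk =>
        charpoly_specMatrix_eval_eq_zero (by omega) hinj gam (hdet0 k hk)
  obtain ⟨D, hDdeg, hD⟩ := exists_polynomial_det_condMatrix (r := r) (by omega) n a lam gam
  have hDmu := eq_C_mul_nodal hDdeg hmu' fun k hk => (hD _).trans (hdet0 k hk)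
  have hwr : ∀ x, wrDet (r * n) (phiFam r n f lam gam) x
      = D.coeff n * (specMatrix r n a lam gam).charpoly.eval x := fun x => by
    rw [hchar, hdet, ← hD]
    conv_lhs => rw [hDmu]
    simp
  intro x z hx hz hqz hτx
  have hc : D.coeff n ≠ 0 := fun h => hx (by rw [hwr, h, zero_mul])
  rw [← Lagrange.eval_nodal] at hqz hτx ⊢
  rw [← Lagrange.eval_nodal]
  obtain ⟨E, hEdeg, hE⟩ := exists_wrDetB_eq_mul_bakerFun hr hn hA hlam' hwr hqz
  simp only [hchar] at hwr hE
  have hdual := wrDetB_eq_mul_bakerFun hr hn hA mu gam' z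
    (isMonicOfDegree_nodal n mu) (fun l _ => hEdeg l) (fun k hk j hj => ?_) hfbA x
  · rw [hdual, hE fb hfbA, hwr]
    field_simp
  · have h := hgam' k hk (fun t => f j (t + z))
      ((hf j hj).comp (differentiable_id.add_const z))
    have h1 := funext (hE (f j) (hA j hj))
    rw [h1, deriv_const_mul_field, mul_left_comm, ← mul_add] at h
    exact (mul_eq_zero.1 h).resolve_left (mul_ne_zero hc hqz)
end
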